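/- arXiv:2006.08166 — 4 statements merged into one kernel-verified Lean document; each statement's English description precedes it below -/
import Mathlib

section
/- The set Π = {(y, x) ∈ C_{p+1,q} × C_{p,q} : there exists g̃ ∈ U(p+1,q) with π(g̃ · d_y · g̃⁻¹) = d_x} is a convex set, is stable under multiplication by every positive real scalar, and is closed in the subspace topology of C_{p+1,q} × C_{p,q} ⊆ ℝ^{ñ} × ℝⁿ. -/
open Matrix Complex Pointwise

noncomputable def Ipq (p q : ℕ) : Matrix (Fin (p + q)) (Fin (p + q)) ℂ :=
  Matrix.diagonal fun i => if (i : ℕ) < p then 1 else -1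

/-- The pseudo-unitary group `U(p,q)` as a set of matrices. -/
def Upq (p q : ℕ) : Set (Matrix (Fin (p + q)) (Fin (p + q)) ℂ) :=
  {g | IsUnit g ∧ g * Ipq p q * g.conjTranspose = Ipq p q}

/-- The diagonal matrix with entries `i * x_k`. -/
noncomputable def dmat {n : ℕ} (x : Fin n → ℝ) : Matrix (Fin n) (Fin n) ℂ :=
  Matrix.diagonal fun i => Complex.I * (x i : ℂ)

/-- The holomorphic chamber `C_{p,q}`: `x_1 ≥ ⋯ ≥ x_p > x_{p+1} ≥ ⋯ ≥ x_{p+q}`. -/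
def Chol (p q : ℕ) : Set (Fin (p + q) → ℝ) :=
  {x | (∀ i j : Fin (p + q), (i : ℕ) ≤ (j : ℕ) → ((j : ℕ) < p ∨ p ≤ (i : ℕ)) → x j ≤ x i) ∧
       ∀ i j : Fin (p + q), (i : ℕ) < p → p ≤ (j : ℕ) → x j < x i}

/-- The adjoint orbit `O_x = {g d_x g⁻¹ : g ∈ U(p,q)}`. -/
def Orbit (p q : ℕ) (x : Fin (p + q) → ℝ) : Set (Matrix (Fin (p + q)) (Fin (p + q)) ℂ) :=
  {Y | ∃ g ∈ Upq p q, Y = g * dmat x * g⁻¹}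

/-- The embedding `Fin (p+q) → Fin (p+1+q)` skipping the `(p+1)`-st index (0-based index `p`). -/
def embed (p q : ℕ) (i : Fin (p + q)) : Fin (p + 1 + q) :=
  if (i : ℕ) < p then ⟨(i : ℕ), by have := i.isLt; omega⟩
  else ⟨(i : ℕ) + 1, by have := i.isLt; omega⟩

/-- The projection `M_{ñ}(ℂ) → M_n(ℂ)` deleting the `(p+1)`-st row and column. -/
def projMat (p q : ℕ) (X : Matrix (Fin (p + 1 + q)) (Fin (p + 1 + q)) ℂ) :
    Matrix (Fin (p + q)) (Fin (p + q)) ℂ :=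
  fun i j => X (embed p q i) (embed p q j)

/-- The set `Π = {(y,x) ∈ C_{p+1,q} × C_{p,q} : ∃ g̃ ∈ U(p+1,q), π(g̃ d_y g̃⁻¹) = d_x}`. -/
def PiHol (p q : ℕ) : Set ((Fin (p + 1 + q) → ℝ) × (Fin (p + q) → ℝ)) :=
  {yx | yx.1 ∈ Chol (p + 1) q ∧ yx.2 ∈ Chol p q ∧
        ∃ g ∈ Upq (p + 1) q, projMat p q (g * dmat yx.1 * g⁻¹) = dmat yx.2}

/-- A subspace cut out by fewer linear equations than the dimension is nonzero. -/
lemma exists_ne_zero_of_card_lt {K N A B : Type*} [Fintype K] [Fintype A] [Fintype B]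
    (T : (K → ℂ) →ₗ[ℂ] (N → ℂ)) (a : A → K) (b : B → N)
    (h : Fintype.card A + Fintype.card B < Fintype.card K) :
    ∃ u : K → ℂ, u ≠ 0 ∧ (∀ i, u (a i) = 0) ∧ ∀ j, T u (b j) = 0 := by
  let f : (K → ℂ) →ₗ[ℂ] (A ⊕ B → ℂ) :=
    LinearMap.pi (Sum.elim (fun i => LinearMap.proj (a i)) fun j => LinearMap.proj (b j) ∘ₗ T)
  have hf : f.ker ≠ ⊥ := LinearMap.ker_ne_bot_of_finrank_lt (by simpa using h)
  obtain ⟨u, hu, hu0⟩ := (Submodule.ne_bot_iff _).1 hf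
  rw [LinearMap.mem_ker] at hu
  exact ⟨u, hu0, fun i => congrFun hu (Sum.inl i), fun j => congrFun hu (Sum.inr j)⟩

lemma sum_mul_norm_sq_neg {K : Type*} [Fintype K] {β : K → ℝ} {u : K → ℂ} (hu : u ≠ 0)
    (h : ∀ k, ¬ β k < 0 → u k = 0) : ∑ k, β k * ‖u k‖ ^ 2 < 0 := by
  obtain ⟨k, hk⟩ := Function.ne_iff.1 hu
  have hk' : u k ≠ 0 := hk
  refine Finset.sum_neg' (fun i _ => ?_) ⟨k, Finset.mem_univ _, ?_⟩
  · by_cases hi : β i < 0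
    · exact mul_nonpos_of_nonpos_of_nonneg hi.le (by positivity)
    · simp [h i hi]
  · exact mul_neg_of_neg_of_pos (by_contra fun hn => hk' (h k hn)) (by positivity)

lemma sum_mul_norm_sq_nonneg {K : Type*} [Fintype K] {β : K → ℝ} {u : K → ℂ}
    (h : ∀ k, β k < 0 → u k = 0) : 0 ≤ ∑ k, β k * ‖u k‖ ^ 2 := by
  refine Finset.sum_nonneg fun i _ => ?_
  by_cases hi : β i < 0
  · simp [h i hi]
  · exact mul_nonneg (not_lt.1 hi) (by positivity)

/-- The negative index of a diagonal Hermitian form does not increase under restriction. -/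
lemma card_neg_le_card_neg {K N : Type*} [Fintype K] [Fintype N] (T : (K → ℂ) →ₗ[ℂ] (N → ℂ))
    (α : N → ℝ) (β : K → ℝ)
    (h : ∀ u, ∑ m, α m * ‖T u m‖ ^ 2 = ∑ k, β k * ‖u k‖ ^ 2) :
    Fintype.card {k // β k < 0} ≤ Fintype.card {m // α m < 0} := by
  by_contra! hlt
  have hc := Fintype.card_subtype_compl (fun k => β k < 0)
  have hle := Fintype.card_subtype_le (fun k => β k < 0)
  obtain ⟨u, hu, h1, h2⟩ := exists_ne_zero_of_card_lt T
    (Subtype.val : {k // ¬ β k < 0} → K) (Subtype.val : {m // α m < 0} → N) (by omega)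
  have := sum_mul_norm_sq_neg hu fun k hk => h1 ⟨k, hk⟩
  have := sum_mul_norm_sq_nonneg (u := T u) fun m hm => h2 ⟨m, hm⟩
  linarith [h u]

/-- The negative index of a diagonal Hermitian form drops by at most the codimension under
restriction. -/
lemma card_neg_le_card_neg_add {K N : Type*} [Fintype K] [Fintype N]
    (T : (K → ℂ) →ₗ[ℂ] (N → ℂ)) (hT : Function.Injective T) (α : N → ℝ) (β : K → ℝ)
    (h : ∀ u, ∑ m, α m * ‖T u m‖ ^ 2 = ∑ k, β k * ‖u k‖ ^ 2) :
    Fintype.card {m // α m < 0} + Fintype.card K ≤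
      Fintype.card {k // β k < 0} + Fintype.card N := by
  by_contra! hlt
  have hc := Fintype.card_subtype_compl (fun m => α m < 0)
  have hle := Fintype.card_subtype_le (fun m => α m < 0)
  obtain ⟨u, hu, h1, h2⟩ := exists_ne_zero_of_card_lt T
    (Subtype.val : {k // β k < 0} → K) (Subtype.val : {m // ¬ α m < 0} → N) (by omega)
  have := sum_mul_norm_sq_nonneg fun k hk => h1 ⟨k, hk⟩
  have := sum_mul_norm_sq_neg ((map_ne_zero_iff T hT).2 hu) fun m hm => h2 ⟨m, hm⟩
  linarith [h u]

lemma dotProduct_diagonal_mulVec {K : Type*} [Fintype K] [DecidableEq K] (γ : K → ℝ)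
    (w : K → ℂ) :
    star w ⬝ᵥ (diagonal (fun i => (γ i : ℂ)) *ᵥ w) = ((∑ i, γ i * ‖w i‖ ^ 2 : ℝ) : ℂ) := by
  simp only [dotProduct, mulVec_diagonal, Pi.star_apply, Complex.ofReal_sum, Complex.ofReal_mul,
    Complex.ofReal_pow]
  refine Finset.sum_congr rfl fun i _ => ?_
  rw [← Complex.conj_mul']
  simp only [RCLike.star_def]
  ring

/-- A Hermitian diagonalization `G D Gᴴ = D'` is an identity of quadratic forms. -/
lemma sum_mul_norm_sq_eq_of_mul_diagonal {K N : Type*} [Fintype K] [Fintype N] [DecidableEq K]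
    [DecidableEq N] {G : Matrix K N ℂ} {α : N → ℝ} {β : K → ℝ}
    (h : G * diagonal (fun m => (α m : ℂ)) * Gᴴ = diagonal fun k => (β k : ℂ)) (u : K → ℂ) :
    ∑ m, α m * ‖(Gᴴ *ᵥ u) m‖ ^ 2 = ∑ k, β k * ‖u k‖ ^ 2 := by
  have := dotProduct_diagonal_mulVec β u
  rw [← h, ← mulVec_mulVec, ← mulVec_mulVec, dotProduct_mulVec] at this
  have h' := dotProduct_diagonal_mulVec α (Gᴴ *ᵥ u)
  rw [star_mulVec, conjTranspose_conjTranspose, this] at h'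
  exact_mod_cast h'.symm

/-- The sign `ε_k` of the `k`-th diagonal entry of `I_{p,q}`. -/
noncomputable def sgn (p k : ℕ) : ℝ := if k < p then 1 else -1

lemma sgn_mul_self (p k : ℕ) : sgn p k * sgn p k = 1 := by
  unfold sgn; split_ifs <;> norm_num

lemma Ipq_eq (p q : ℕ) : Ipq p q = diagonal fun i : Fin (p + q) => ((sgn p i : ℝ) : ℂ) := by
  unfold Ipq sgn
  congr 1
  ext i
  split_ifs <;> simp

lemma Ipq_mul_self (p q : ℕ) : Ipq p q * Ipq p q = 1 := by
  rw [Ipq_eq, diagonal_mul_diagonal, ← diagonal_one]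
  congr 1
  ext i
  exact_mod_cast sgn_mul_self p i

lemma embed_val (p q : ℕ) (i : Fin (p + q)) :
    (embed p q i : ℕ) = if (i : ℕ) < p then (i : ℕ) else i + 1 := by
  unfold embed
  split_ifs <;> rfl

lemma sgn_embed (p q : ℕ) (i : Fin (p + q)) : sgn (p + 1) (embed p q i) = sgn p i := by
  unfold sgn
  rw [embed_val]
  split_ifs <;> first | rfl | omega

lemma embed_injective (p q : ℕ) : Function.Injective (embed p q) := by
  intro i j h
  have := congrArg Fin.val h
  rw [embed_val, embed_val] at this
  ext
  split_ifs at this <;> omega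

lemma dmat_mul_Ipq {p q : ℕ} (x : Fin (p + q) → ℝ) :
    dmat x * Ipq p q = Complex.I • diagonal fun k : Fin (p + q) => ((sgn p k * x k : ℝ) : ℂ) := by
  rw [dmat, Ipq_eq, diagonal_mul_diagonal, ← diagonal_smul]
  congr 1
  ext i
  simp
  ring

lemma inv_mul_Ipq {p q : ℕ} {g : Matrix (Fin (p + q)) (Fin (p + q)) ℂ} (hg : g ∈ Upq p q) :
    g⁻¹ * Ipq p q = Ipq p q * gᴴ := by
  nth_rewrite 1 [← hg.2]
  rw [Matrix.mul_assoc g, nonsing_inv_mul_cancel_left _ _ ((isUnit_iff_isUnit_det g).1 hg.1)]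

/-- In terms of the Hermitian matrix `g diag(ε y) gᴴ`, the projection condition says that its
principal submatrix is `diag(ε x)`. -/
lemma projMat_eq_dmat_iff {p q : ℕ} {g : Matrix (Fin (p + 1 + q)) (Fin (p + 1 + q)) ℂ}
    (hg : g ∈ Upq (p + 1) q) (y : Fin (p + 1 + q) → ℝ) (x : Fin (p + q) → ℝ) :
    projMat p q (g * dmat y * g⁻¹) = dmat x ↔
      (g * diagonal (fun m : Fin (p + 1 + q) => ((sgn (p + 1) m * y m : ℝ) : ℂ)) * gᴴ).submatrix
        (embed p q) (embed p q) = diagonal fun k : Fin (p + q) => ((sgn p k * x k : ℝ) : ℂ) := by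
  have h1 : g * dmat y * g⁻¹ * Ipq (p + 1) q = Complex.I •
      (g * diagonal (fun m : Fin (p + 1 + q) => ((sgn (p + 1) m * y m : ℝ) : ℂ)) * gᴴ) := by
    rw [Matrix.mul_assoc, inv_mul_Ipq hg, ← Matrix.mul_assoc, Matrix.mul_assoc g, dmat_mul_Ipq]
    simp
  have h2 (X : Matrix (Fin (p + 1 + q)) (Fin (p + 1 + q)) ℂ) :
      projMat p q X * Ipq p q = (X * Ipq (p + 1) q).submatrix (embed p q) (embed p q) := by
    ext i j
    simp [projMat, Ipq_eq, sgn_embed]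
  have h3 : projMat p q (g * dmat y * g⁻¹) = dmat x ↔
      projMat p q (g * dmat y * g⁻¹) * Ipq p q = dmat x * Ipq p q :=
    ⟨fun h => by rw [h], fun h => by
      simpa [Matrix.mul_assoc, Ipq_mul_self] using congrArg (· * Ipq p q) h⟩
  rw [h3, h2, h1, dmat_mul_Ipq, submatrix_smul, Pi.smul_apply]
  exact (smul_right_injective _ Complex.I_ne_zero).eq_iff

/-- The form `H - a J` restricted to the hyperplane, in both diagonalizations. -/
lemma submatrix_mul_diagonal_mul {p q : ℕ} {g : Matrix (Fin (p + 1 + q)) (Fin (p + 1 + q)) ℂ}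
    (hg : g ∈ Upq (p + 1) q) {y : Fin (p + 1 + q) → ℝ} {x : Fin (p + q) → ℝ}
    (h : projMat p q (g * dmat y * g⁻¹) = dmat x) (a b : ℝ) :
    g.submatrix (embed p q) id *
      diagonal (fun m : Fin (p + 1 + q) => ((sgn (p + 1) m * (b * y m - a) : ℝ) : ℂ)) *
      (g.submatrix (embed p q) id)ᴴ =
      diagonal fun k : Fin (p + q) => ((sgn p k * (b * x k - a) : ℝ) : ℂ) := by
  have hx := (projMat_eq_dmat_iff hg y x).1 h
  have hJ := hg.2
  rw [Ipq_eq] at hJ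
  have hJ' : (g * diagonal (fun m : Fin (p + 1 + q) => ((sgn (p + 1) m : ℝ) : ℂ)) *
      gᴴ).submatrix (embed p q) (embed p q) =
      diagonal fun k : Fin (p + q) => ((sgn p k : ℝ) : ℂ) := by
    rw [hJ, submatrix_diagonal _ _ (embed_injective p q)]
    congr 1
    ext k
    simp [sgn_embed]
  have hd {n r : ℕ} (z : Fin n → ℝ) :
      diagonal (fun k : Fin n => ((sgn r k * (b * z k - a) : ℝ) : ℂ)) =
      (b : ℂ) • diagonal (fun k : Fin n => ((sgn r k * z k : ℝ) : ℂ)) -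
      (a : ℂ) • diagonal (fun k : Fin n => ((sgn r k : ℝ) : ℂ)) := by
    rw [← diagonal_smul, ← diagonal_smul, diagonal_sub]
    congr 1
    ext k
    simp
    ring
  rw [hd, hd, ← hx, ← hJ', Matrix.mul_sub, Matrix.sub_mul, Matrix.mul_smul, Matrix.mul_smul,
    Matrix.smul_mul, Matrix.smul_mul]
  rfl

/-- The interlacing inequalities describing the pairs `(y, x)`. -/
def Interlaces (p q : ℕ) (y : Fin (p + 1 + q) → ℝ) (x : Fin (p + q) → ℝ) : Prop :=
  ∀ k j, (j ≤ embed p q k → x k ≤ y j) ∧ (embed p q k < j → y j ≤ x k)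

lemma Chol.antitone {p q : ℕ} {x : Fin (p + q) → ℝ} (hx : x ∈ Chol p q) : Antitone x := by
  intro i j hij
  by_cases h : (j : ℕ) < p ∨ p ≤ (i : ℕ)
  · exact hx.1 i j hij h
  · push Not at h
    exact (hx.2 i j h.2 h.1).le

lemma card_le_of_val_mem_Ico {n : ℕ} (P : Fin n → Prop) [DecidablePred P] (a b : ℕ)
    (h : ∀ i, P i → a ≤ (i : ℕ) ∧ (i : ℕ) < b) : Fintype.card {i // P i} ≤ b - a := by
  rw [← Nat.card_Ico a b, Fintype.card_subtype]
  exact Finset.card_le_card_of_injOn Fin.val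
    (fun i hi => by simpa using h i (by simpa using hi)) Fin.val_injective.injOn

lemma le_card_of_val_mem_Ico {n : ℕ} (P : Fin n → Prop) [DecidablePred P] (a b : ℕ) (hb : b ≤ n)
    (h : ∀ i : Fin n, a ≤ (i : ℕ) → (i : ℕ) < b → P i) : b - a ≤ Fintype.card {i // P i} := by
  rw [← Nat.card_Ico a b, Fintype.card_subtype,
    ← Finset.card_image_of_injective _ (Fin.val_injective (n := n))]
  refine Finset.card_le_card fun i hi => ?_
  rw [Finset.mem_Ico] at hi
  exact Finset.mem_image.2 ⟨⟨i, by omega⟩, by simpa using h ⟨i, by omega⟩ hi.1 hi.2, rfl⟩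

lemma sgn_mul_neg_iff (p k : ℕ) (z : ℝ) :
    sgn p k * z < 0 ↔ (k < p ∧ z < 0) ∨ (p ≤ k ∧ 0 < z) := by
  unfold sgn
  split_ifs with h
  · simp [h, h.not_ge]
  · simp [h, not_lt.1 h]

lemma interlaces_of_projMat {p q : ℕ} (hq : 1 ≤ q) {y : Fin (p + 1 + q) → ℝ}
    {x : Fin (p + q) → ℝ} (hy : y ∈ Chol (p + 1) q) (hx : x ∈ Chol p q)
    {g : Matrix (Fin (p + 1 + q)) (Fin (p + 1 + q)) ℂ} (hg : g ∈ Upq (p + 1) q)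
    (h : projMat p q (g * dmat y * g⁻¹) = dmat x) : Interlaces p q y x := by
  have hya := Chol.antitone hy
  have hxa := Chol.antitone hx
  set G := g.submatrix (embed p q) id with hG
  let T : (Fin (p + q) → ℂ) →ₗ[ℂ] (Fin (p + 1 + q) → ℂ) := mulVecLin Gᴴ
  have hT : Function.Injective T := by
    have h1 := submatrix_mul_diagonal_mul hg h (-1) 0
    have h2 := Ipq_mul_self p q
    simp only [zero_mul, sub_neg_eq_add, zero_add, mul_one] at h1
    rw [Ipq_eq] at h2
    have h3 : (diagonal fun k : Fin (p + q) => ((sgn p k : ℝ) : ℂ)) *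
        (G * diagonal fun m : Fin (p + 1 + q) => ((sgn (p + 1) m : ℝ) : ℂ)) * Gᴴ = 1 := by
      rw [Matrix.mul_assoc, h1, h2]
    exact Function.LeftInverse.injective (g := mulVec _) fun u => by
      rw [mulVecLin_apply, mulVec_mulVec, h3, one_mulVec]
  have hform (a : ℝ) (u) : ∑ m : Fin (p + 1 + q), sgn (p + 1) m * (y m - a) * ‖T u m‖ ^ 2 =
      ∑ k : Fin (p + q), sgn p k * (x k - a) * ‖u k‖ ^ 2 := by
    have := sum_mul_norm_sq_eq_of_mul_diagonal (submatrix_mul_diagonal_mul hg h a 1) u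
    simp only [one_mul] at this
    exact this
  have hle (a : ℝ) := card_neg_le_card_neg T _ _ (hform a)
  have hge (a : ℝ) := card_neg_le_card_neg_add T hT _ _ (hform a)
  simp only [Fintype.card_fin] at hge
  simp only [sgn_mul_neg_iff, sub_neg, sub_pos] at hle hge
  -- any value in the spectral gap of `y` separates the two groups of coordinates of `x`
  have hgap (a : ℝ) (h1 : ∀ m : Fin (p + 1 + q), (m : ℕ) < p + 1 → a ≤ y m)
      (h2 : ∀ m : Fin (p + 1 + q), p + 1 ≤ (m : ℕ) → y m ≤ a) (k : Fin (p + q)) :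
      ((k : ℕ) < p → a ≤ x k) ∧ (p ≤ (k : ℕ) → x k ≤ a) := by
    have h0 := hle a
    have : Fintype.card {m : Fin (p + 1 + q) // ((m : ℕ) < p + 1 ∧ y m < a) ∨
        (p + 1 ≤ (m : ℕ) ∧ a < y m)} = 0 := by
      rw [Fintype.card_eq_zero_iff]
      refine ⟨fun ⟨m, hm⟩ => ?_⟩
      rcases hm with hm | hm
      · exact (h1 m hm.1).not_gt hm.2
      · exact (h2 m hm.1).not_gt hm.2
    rw [this, Nat.le_zero, Fintype.card_eq_zero_iff] at h0
    constructor <;> intro hk <;> by_contra! hc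
    · exact h0.false ⟨k, Or.inl ⟨hk, hc⟩⟩
    · exact h0.false ⟨k, Or.inr ⟨hk, hc⟩⟩
  have hxp (k : Fin (p + q)) (hk : (k : ℕ) < p) (m : Fin (p + 1 + q)) (hm : p ≤ (m : ℕ)) :
      y m ≤ x k := by
    refine (hya (show ⟨p, by omega⟩ ≤ m from hm)).trans ((hgap _ (fun i hi => hya ?_)
      (fun i hi => hya ?_) k).1 hk)
    · exact Fin.le_def.2 (by simp; omega)
    · exact Fin.le_def.2 (by simp; omega)
  have hxq (k : Fin (p + q)) (hk : p ≤ (k : ℕ)) (m : Fin (p + 1 + q)) (hm : (m : ℕ) ≤ p + 1) :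
      x k ≤ y m := by
    refine ((hgap (y ⟨p + 1, by omega⟩) (fun i hi => hya ?_) (fun i hi => hya ?_) k).2 hk).trans
      (hya (show m ≤ ⟨p + 1, by omega⟩ from hm))
    · exact Fin.le_def.2 (by simp; omega)
    · exact Fin.le_def.2 (by simp; omega)
  intro k j
  rw [Fin.le_def, Fin.lt_def, embed_val]
  have hkn := k.isLt
  have hjn := j.isLt
  constructor <;> intro hjk <;> by_contra! hlt <;> obtain ⟨a, ha1, ha2⟩ := exists_between hlt <;>
    split_ifs at hjk with hk
  · have h1 := le_card_of_val_mem_Ico (fun m : Fin (p + 1 + q) => ((m : ℕ) < p + 1 ∧ y m < a) ∨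
      (p + 1 ≤ (m : ℕ) ∧ a < y m)) k (p + 1) (by omega)
      fun m h1 h2 => Or.inl ⟨h2, (hya (Fin.le_def.2 (by omega))).trans_lt ha1⟩
    have h2 := card_le_of_val_mem_Ico (fun m : Fin (p + q) => ((m : ℕ) < p ∧ x m < a) ∨
      (p ≤ (m : ℕ) ∧ a < x m)) (k + 1) p fun m hm => by
        rcases hm with hm | hm
        · refine ⟨?_, hm.1⟩
          by_contra! hc
          exact (ha2.trans_le (hxa (Fin.le_def.2 (by omega)))).not_gt hm.2
        · exact absurd (hm.2.trans_le (hxq m hm.1 j (by omega))) ha1.not_gt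
    have := hge a
    omega
  · have h1 := le_card_of_val_mem_Ico (fun m : Fin (p + q) => ((m : ℕ) < p ∧ x m < a) ∨
      (p ≤ (m : ℕ) ∧ a < x m)) p (k + 1) (by omega)
      fun m h1 h2 => Or.inr ⟨h1, ha2.trans_le (hxa (Fin.le_def.2 (by omega)))⟩
    have h2 := card_le_of_val_mem_Ico (fun m : Fin (p + 1 + q) => ((m : ℕ) < p + 1 ∧ y m < a) ∨
      (p + 1 ≤ (m : ℕ) ∧ a < y m)) (p + 1) (k + 1) fun m hm => by
        rcases hm with hm | hm
        · exact absurd (ha2.trans_le (hxq k (by omega) m (by omega))) hm.2.not_gt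
        · refine ⟨hm.1, ?_⟩
          by_contra! hc
          exact ((hya (Fin.le_def.2 (by omega))).trans_lt ha1).not_gt hm.2
    have := hle a
    omega
  · have h1 := le_card_of_val_mem_Ico (fun m : Fin (p + q) => ((m : ℕ) < p ∧ x m < a) ∨
      (p ≤ (m : ℕ) ∧ a < x m)) k p (by omega)
      fun m h1 h2 => Or.inl ⟨h2, (hxa (Fin.le_def.2 (by omega))).trans_lt ha1⟩
    have h2 := card_le_of_val_mem_Ico (fun m : Fin (p + 1 + q) => ((m : ℕ) < p + 1 ∧ y m < a) ∨
      (p + 1 ≤ (m : ℕ) ∧ a < y m)) (j + 1) (p + 1) fun m hm => by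
        rcases hm with hm | hm
        · refine ⟨?_, hm.1⟩
          by_contra! hc
          exact (ha2.trans_le (hya (Fin.le_def.2 (by omega)))).not_gt hm.2
        · exact absurd (hm.2.trans_le (hxp k hk m (by omega))) ha1.not_gt
    have := hle a
    omega
  · have h1 := le_card_of_val_mem_Ico (fun m : Fin (p + 1 + q) => ((m : ℕ) < p + 1 ∧ y m < a) ∨
      (p + 1 ≤ (m : ℕ) ∧ a < y m)) (p + 1) (j + 1) (by omega)
      fun m h1 h2 => Or.inr ⟨h1, ha2.trans_le (hya (Fin.le_def.2 (by omega)))⟩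
    have h2 := card_le_of_val_mem_Ico (fun m : Fin (p + q) => ((m : ℕ) < p ∧ x m < a) ∨
      (p ≤ (m : ℕ) ∧ a < x m)) p k fun m hm => by
        rcases hm with hm | hm
        · exact absurd (ha2.trans_le (hxp m hm.1 j (by omega))) hm.2.not_gt
        · refine ⟨hm.1, ?_⟩
          by_contra! hc
          exact ((hxa (Fin.le_def.2 (by omega))).trans_lt ha1).not_gt hm.2
    have := hge a
    omega

lemma exists_perm_of_map_univ_eq {N R : Type*} [Fintype N] [DecidableEq R] {f g : N → R}
    (h : Finset.univ.val.map f = Finset.univ.val.map g) :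
    ∃ σ : Equiv.Perm N, ∀ k, g (σ k) = f k := by
  have hc (c : R) : Fintype.card {a // f a = c} = Fintype.card {a // g a = c} := by
    have := congrArg (Multiset.count c) h
    rw [Multiset.count_map, Multiset.count_map] at this
    simp only [Fintype.card_subtype, Finset.card_def, Finset.filter_val, eq_comm (a := c)] at this ⊢
    exact this
  let e (c : R) : {a // f a = c} ≃ {a // g a = c} := Fintype.equivOfCardEq (hc c)
  exact ⟨Equiv.ofFiberEquiv e, Equiv.ofFiberEquiv_map e⟩

/-- Two families with the same monic polynomial agree up to a permutation. -/
lemma exists_perm_of_prod_sub_eq {N : Type*} [Fintype N] {f g : N → ℝ} {S : Set ℝ}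
    (hS : S.Infinite) (h : ∀ t ∈ S, ∏ k, (t - f k) = ∏ k, (t - g k)) :
    ∃ σ : Equiv.Perm N, ∀ k, g (σ k) = f k := by
  open Polynomial in
  have hp : ∏ k, (X - C (f k)) = ∏ k, (X - C (g k)) := by
    refine eq_of_infinite_eval_eq _ _ (hS.mono fun t ht => ?_)
    simpa [eval_prod] using h t ht
  have hr (z : N → ℝ) : (∏ k, (Polynomial.X - Polynomial.C (z k))).roots =
      Finset.univ.val.map z := by
    rw [← Polynomial.roots_multiset_prod_X_sub_C (Finset.univ.val.map z), Multiset.map_map]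
    rfl
  exact exists_perm_of_map_univ_eq (by rw [← hr, ← hr, hp])

/-- A positive definite matrix, presented as `B Bᴴ`, and a Hermitian matrix `J` are simultaneously
diagonalizable by congruence. -/
lemma exists_simultaneous_diagonalization {N : Type*} [Fintype N] [DecidableEq N]
    {B J : Matrix N N ℂ} (hB : IsUnit B) (hJ : J.IsHermitian) :
    ∃ (G : Matrix N N ℂ) (μ : N → ℝ), IsUnit G ∧ G * Gᴴ = B * Bᴴ ∧
      G * diagonal (fun k => (μ k : ℂ)) * Gᴴ = J := by
  have hBd := (isUnit_iff_isUnit_det B).1 hB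
  have hS : (B⁻¹ * J * B⁻¹ᴴ).IsHermitian := isHermitian_mul_mul_conjTranspose _ hJ
  have hU : (hS.eigenvectorUnitary : Matrix N N ℂ) * (hS.eigenvectorUnitary : Matrix N N ℂ)ᴴ = 1 :=
    Unitary.coe_mul_star_self _
  have hsp := hS.spectral_theorem
  rw [Unitary.conjStarAlgAut_apply] at hsp
  set U := (hS.eigenvectorUnitary : Matrix N N ℂ)
  refine ⟨B * U, hS.eigenvalues, hB.mul (IsUnit.of_mul_eq_one _ hU), ?_, ?_⟩
  · rw [conjTranspose_mul, Matrix.mul_assoc, ← Matrix.mul_assoc U, hU, Matrix.one_mul]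
  · have : B * U * diagonal (fun k => (hS.eigenvalues k : ℂ)) * (B * U)ᴴ =
        B * (U * diagonal (fun k => (hS.eigenvalues k : ℂ)) * star U) * Bᴴ := by
      rw [conjTranspose_mul, star_eq_conjTranspose]
      simp only [Matrix.mul_assoc]
    rw [this]
    have hsp' : B⁻¹ * J * B⁻¹ᴴ = U * diagonal (fun k => (hS.eigenvalues k : ℂ)) * star U := hsp
    rw [← hsp', Matrix.mul_assoc B⁻¹, mul_nonsing_inv_cancel_left _ _ hBd, Matrix.mul_assoc,
      ← conjTranspose_mul, mul_nonsing_inv _ hBd, conjTranspose_one, Matrix.mul_one]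

/-- If `H - s J` is positive definite, `H` can be brought to diagonal form by a pseudo-unitary
matrix, the order of the eigenvalues being fixed by the signs of `y - s`. -/
lemma exists_pseudoUnitary_diagonalization {N : Type*} [Fintype N] [DecidableEq N]
    {ε y : N → ℝ} {s : ℝ} (hε : ∀ k, ε k * ε k = 1) (hpos : ∀ k, 0 < ε k * (y k - s))
    {B H : Matrix N N ℂ} (hB : IsUnit B)
    (hH : H = B * Bᴴ + (s : ℂ) • diagonal fun k => (ε k : ℂ)) {S : Set ℝ} (hS : S.Infinite)
    (hdet : ∀ t ∈ S, (H - (t : ℂ) • diagonal fun k => (ε k : ℂ)).det =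
      ∏ k, ((ε k * (y k - t) : ℝ) : ℂ)) :
    ∃ g : Matrix N N ℂ, IsUnit g ∧
      g * diagonal (fun k => (ε k : ℂ)) * gᴴ = diagonal (fun k => (ε k : ℂ)) ∧
      g * diagonal (fun k => ((ε k * y k : ℝ) : ℂ)) * gᴴ = H := by
  have hε0 (k) : ε k ≠ 0 := fun h => by simpa [h] using hε k
  obtain ⟨G, μ, hG, hGB, hGJ⟩ := exists_simultaneous_diagonalization hB
    (J := diagonal fun k => (ε k : ℂ)) (isHermitian_diagonal_of_self_adjoint _ (by
      ext k; simp))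
  have hdG : G.det * Gᴴ.det ≠ 0 := by
    have h1 := ((isUnit_iff_isUnit_det G).1 hG).ne_zero
    rw [det_conjTranspose]
    exact mul_ne_zero h1 (star_ne_zero.2 h1)
  have hdJ : (∏ k, (ε k : ℂ)) = G.det * Gᴴ.det * ∏ k, (μ k : ℂ) := by
    have := congrArg det hGJ
    rw [det_mul, det_mul, det_diagonal, det_diagonal] at this
    rw [← this]
    ring
  have hμ (k) : μ k ≠ 0 := by
    have h1 : (∏ k, (ε k : ℂ)) ≠ 0 := Finset.prod_ne_zero_iff.2 fun k _ => by simpa using hε0 k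
    rw [hdJ] at h1
    simpa using Finset.prod_ne_zero_iff.1 (right_ne_zero_of_mul h1) k (Finset.mem_univ k)
  have hHt (t : ℂ) : H - t • diagonal (fun k => (ε k : ℂ)) =
      G * diagonal (fun k => 1 + (s - t) * (μ k : ℂ)) * Gᴴ := by
    have : diagonal (fun k => 1 + (s - t) * (μ k : ℂ)) =
        1 + ((s : ℂ) - t) • diagonal fun k => (μ k : ℂ) := by
      rw [← diagonal_one, ← diagonal_smul, diagonal_add]
      rfl
    rw [this, Matrix.mul_add, Matrix.add_mul, Matrix.mul_one, Matrix.mul_smul, Matrix.smul_mul,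
      hGJ, hGB, hH, sub_smul]
    abel
  obtain ⟨σ, hσ⟩ := exists_perm_of_prod_sub_eq (f := y) (g := fun k => s + (μ k)⁻¹) hS
    fun t ht => by
    have h1 := hdet t ht
    rw [hHt, det_mul, det_mul, det_diagonal] at h1
    have h2 : ∏ k, ((ε k * (y k - t) : ℝ) : ℂ) =
        G.det * Gᴴ.det * ∏ k, ((μ k * (y k - t) : ℝ) : ℂ) := by
      simp only [Complex.ofReal_mul, Finset.prod_mul_distrib]
      rw [hdJ]
      ring
    rw [h2, mul_right_comm] at h1
    have h3 := mul_left_cancel₀ hdG h1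
    have h4 : ∏ k, (1 + (s - t) * μ k) = ∏ k, (μ k * (y k - t)) := by
      exact_mod_cast h3
    have h5 : ∏ k, (1 + (s - t) * μ k) = ∏ k, (μ k * (s + (μ k)⁻¹ - t)) :=
      Finset.prod_congr rfl fun k _ => by field_simp [hμ k]; ring
    rw [h5, Finset.prod_mul_distrib, Finset.prod_mul_distrib] at h4
    have h6 := mul_left_cancel₀ (Finset.prod_ne_zero_iff.2 fun k _ => hμ k) h4
    have hneg (z : N → ℝ) : ∏ k, (t - z k) = (-1) ^ Fintype.card N * ∏ k, (z k - t) := by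
      rw [← Finset.card_univ, ← Finset.prod_neg]
      simp
    rw [hneg, hneg, h6]
  have hμσ (k) : ε k * |μ (σ k)| = μ (σ k) := by
    have h1 := hpos k
    rw [← hσ k] at h1
    simp only [add_sub_cancel_left] at h1
    rcases mul_self_eq_one_iff.1 (hε k) with h | h
    · rw [h, one_mul, inv_pos] at h1
      rw [h, one_mul, abs_of_pos h1]
    · rw [h, neg_one_mul, neg_pos, inv_lt_zero] at h1
      rw [h, abs_of_neg h1]
      ring
  let g : Matrix N N ℂ := G.submatrix id σ * diagonal fun k => ((√|μ (σ k)| : ℝ) : ℂ)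
  have hg (z : N → ℝ) : g * diagonal (fun k => (ε k * z k : ℂ)) * gᴴ =
      G * diagonal (fun k => ((μ k * z (σ.symm k) : ℝ) : ℂ)) * Gᴴ := by
    have h1 : g * diagonal (fun k => (ε k * z k : ℂ)) * gᴴ =
        G.submatrix id σ * diagonal (fun k => ((μ (σ k) * z k : ℝ) : ℂ)) * Gᴴ.submatrix σ id := by
      simp only [g, conjTranspose_mul, diagonal_conjTranspose, conjTranspose_submatrix]
      simp only [Matrix.mul_assoc]
      rw [← Matrix.mul_assoc (diagonal _), diagonal_mul_diagonal, ← Matrix.mul_assoc (diagonal _),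
        diagonal_mul_diagonal]
      congr 3
      ext k
      have h3 : √|μ (σ k)| * (ε k * z k) * √|μ (σ k)| = μ (σ k) * z k := by
        linear_combination (ε k * z k) * Real.mul_self_sqrt (abs_nonneg (μ (σ k))) + z k * hμσ k
      rw [← h3]
      simp
    have h2 : diagonal (fun k => ((μ (σ k) * z k : ℝ) : ℂ)) =
        (diagonal (fun k => ((μ k * z (σ.symm k) : ℝ) : ℂ))).submatrix σ σ := by
      rw [submatrix_diagonal_equiv]
      congr 1
      ext k
      simp
    rw [h1, h2, submatrix_mul_equiv, submatrix_mul_equiv, submatrix_id_id]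
  refine ⟨g, ?_, ?_, ?_⟩
  · rw [isUnit_iff_isUnit_det, det_mul, det_diagonal]
    refine IsUnit.mul ?_ (IsUnit.mk0 _ (Finset.prod_ne_zero_iff.2 fun k _ => ?_))
    · rw [det_permute', IsUnit.mul_iff]
      exact ⟨by simp,
        (isUnit_iff_isUnit_det G).1 hG⟩
    · exact_mod_cast (Real.sqrt_pos.2 (abs_pos.2 (hμ _))).ne'
  · have := hg fun _ => 1
    simp only [Complex.ofReal_one, mul_one] at this
    rw [this, hGJ]
  · have := hHt 0
    have h2 := hg y
    rw [zero_smul, sub_zero] at this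
    simp only [Complex.ofReal_mul] at h2 ⊢
    rw [h2, this]
    congr 3
    ext k
    rw [← hσ (σ.symm k)]
    have : (μ k : ℂ) ≠ 0 := by exact_mod_cast hμ k
    simp only [Equiv.apply_symm_apply]
    push_cast
    field_simp
    ring

open Polynomial in
/-- Partial fraction expansion of `∏ (t - y) / ∏ (t - x)`, with denominators cleared. -/
lemma prod_sub_eq_add_sum_residue {K : Type*} [Fintype K] [DecidableEq K] {x : K → ℝ}
    (hx : Function.Injective x) (y : K ⊕ Unit → ℝ) (t : ℝ) :
    ∏ j, (t - y j) = (t - (∑ j, y j - ∑ k, x k)) * ∏ k, (t - x k) +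
      ∑ k, (∏ j, (x k - y j)) / (∏ m ∈ Finset.univ.erase k, (x k - x m)) *
        ∏ m ∈ Finset.univ.erase k, (t - x m) := by
  set c := ∑ j, y j - ∑ k, x k with hc
  let z : K ⊕ Unit → ℝ := Sum.elim x fun _ => c
  let Q : ℝ[X] := ∏ j, (X - C (y j)) - ∏ j, (X - C (z j))
  have hQe (t : ℝ) : Q.eval t = ∏ j, (t - y j) - (t - c) * ∏ k, (t - x k) := by
    simp [Q, z, eval_prod, Fintype.prod_sum_type, mul_comm]
  have hcard : (Finset.univ : Finset (K ⊕ Unit)).card = Fintype.card K + 1 := by simp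
  have hcoeff (w : K ⊕ Unit → ℝ) : (∏ j, (X - C (w j))).coeff (Fintype.card K) = -∑ j, w j := by
    have := prod_X_sub_C_coeff_card_pred Finset.univ w (by rw [hcard]; omega)
    rwa [hcard, Nat.add_sub_cancel] at this
  have hdeg (w : K ⊕ Unit → ℝ) : (∏ j, (X - C (w j))).natDegree = Fintype.card K + 1 := by
    rw [natDegree_prod_of_monic _ _ fun j _ => monic_X_sub_C _]
    simp
  have hQd : Q.degree < (Finset.univ : Finset K).card := by
    rw [Finset.card_univ, degree_lt_iff_coeff_zero]
    intro m hm
    rw [coeff_sub]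
    rcases hm.eq_or_lt with rfl | hm
    · rw [hcoeff, hcoeff]
      simp [z, hc]
    rcases (Nat.succ_le_of_lt hm).eq_or_lt with rfl | hm
    · have hl (w : K ⊕ Unit → ℝ) : (∏ j, (X - C (w j))).coeff (Fintype.card K).succ = 1 := by
        have := (monic_prod_of_monic Finset.univ _ fun j _ => monic_X_sub_C (w j)).coeff_natDegree
        rwa [hdeg] at this
      rw [hl, hl, sub_self]
    · rw [coeff_eq_zero_of_natDegree_lt (by rw [hdeg]; omega),
        coeff_eq_zero_of_natDegree_lt (by rw [hdeg]; omega), sub_self]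
  have hL := Lagrange.eq_interpolate_of_eval_eq (fun k => Q.eval (x k)) (hx.injOn) hQd
    fun k _ => rfl
  have h1 := congrArg (eval t) hL
  rw [hQe, Lagrange.interpolate_apply, eval_finsetSum] at h1
  rw [← sub_eq_iff_eq_add', h1]
  refine Finset.sum_congr rfl fun k _ => ?_
  have h0 : ∏ m, (x k - x m) = 0 := Finset.prod_eq_zero (Finset.mem_univ k) (sub_self _)
  rw [hQe, h0, mul_zero, sub_zero, eval_mul, eval_C, Lagrange.basis, eval_prod]
  simp only [Lagrange.basisDivisor, eval_mul, eval_C, eval_sub, eval_X, Finset.prod_mul_distrib,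
    Finset.prod_inv_distrib]
  ring

/-- The secular identity `det (H - t J) = det J ∏ (y - t)` for the arrowhead matrix `H` with
diagonal part `ε x`, corner `c = ∑ y - ∑ x` and squared off-diagonal moduli `r`. -/
def Secular {K : Type*} [Fintype K] [DecidableEq K] (ε x : K → ℝ) (y : K ⊕ Unit → ℝ)
    (r : K → ℝ) : Prop :=
  ∀ t, ∏ j, (y j - t) = (∑ j, y j - ∑ k, x k - t) * ∏ k, (x k - t) -
    ∑ k, ε k * r k * ∏ m ∈ Finset.univ.erase k, (x m - t)

lemma exists_secular_of_strict {K : Type*} [Fintype K] [DecidableEq K] {ε x : K → ℝ}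
    {y : K ⊕ Unit → ℝ} (hε : ∀ k, ε k * ε k = 1) (hx : Function.Injective x)
    (h1 : ∀ k m, m ≠ k → 0 ≤ (x k - y (Sum.inl m)) / (x k - x m))
    (h2 : ∀ k, ε k * (x k - y (Sum.inr ())) * (x k - y (Sum.inl k)) ≤ 0) :
    ∃ r : K → ℝ, (∀ k, 0 ≤ r k) ∧ Secular ε x y r := by
  let ρ (k : K) : ℝ :=
    (∏ j, (y j - x k)) / (∏ m ∈ Finset.univ.erase k, (x m - x k))
  refine ⟨fun k => -ε k * ρ k, fun k => ?_, fun t => ?_⟩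
  · have : -ε k * ρ k = -(ε k * (x k - y (Sum.inr ())) * (x k - y (Sum.inl k))) *
        ∏ m ∈ Finset.univ.erase k, (x k - y (Sum.inl m)) / (x k - x m) := by
      have hr : ∏ m ∈ Finset.univ.erase k, (x k - y (Sum.inl m)) / (x k - x m) =
          ∏ m ∈ Finset.univ.erase k, (y (Sum.inl m) - x k) / (x m - x k) :=
        Finset.prod_congr rfl fun m _ => by
          rw [← neg_sub (y (Sum.inl m)), ← neg_sub (x m), neg_div_neg_eq]
      simp only [ρ]
      rw [hr, Fintype.prod_sum_type, ← Finset.mul_prod_erase Finset.univ _ (Finset.mem_univ k),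
        Finset.prod_div_distrib]
      simp
      ring
    show 0 ≤ -ε k * ρ k
    rw [this]
    exact mul_nonneg (neg_nonneg.2 (h2 k))
      (Finset.prod_nonneg fun m hm => h1 k m (Finset.ne_of_mem_erase hm))
  · have h := prod_sub_eq_add_sum_residue (x := fun k => -x k) (neg_injective.comp hx)
      (fun j => -y j) (-t)
    simp only [Finset.sum_neg_distrib, sub_neg_eq_add, neg_add_eq_sub] at h
    rw [h, sub_eq_add_neg (_ * _), ← Finset.sum_neg_distrib]
    congr 1
    · ring
    · refine Finset.sum_congr rfl fun k _ => ?_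
      have : ε k * (-ε k * ρ k) = -ρ k := by linear_combination (-ρ k) * hε k
      rw [this, neg_mul, neg_neg]

lemma Secular.prod_eq {K : Type*} [Fintype K] [DecidableEq K] {ε x : K → ℝ}
    {y : K ⊕ Unit → ℝ} {r : K → ℝ} (h : Secular ε x y r) (hε : ∀ k, ε k * ε k = 1) {t : ℝ}
    (ht : ∀ k, x k ≠ t) :
    ∏ j, (y j - t) = (∏ k, (x k - t)) *
      (∑ j, y j - ∑ k, x k - t - ∑ k, r k / (ε k * (x k - t))) := by
  rw [h t, mul_sub, mul_comm, Finset.mul_sum]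
  congr 1
  refine Finset.sum_congr rfl fun k _ => ?_
  have h1 : x k - t ≠ 0 := sub_ne_zero.2 (ht k)
  have h2 : ε k ≠ 0 := fun h => by simpa [h] using hε k
  rw [← Finset.mul_prod_erase Finset.univ _ (Finset.mem_univ k)]
  field_simp
  linear_combination (r k * ∏ m ∈ Finset.univ.erase k, (x m - t)) * hε k

/-- Positivity of the Schur complement of `H - s J` for `s` in the spectral gap. -/
lemma Secular.sum_div_lt {K : Type*} [Fintype K] [DecidableEq K] {ε x : K → ℝ}
    {y : K ⊕ Unit → ℝ} {r : K → ℝ} (h : Secular ε x y r) (hε : ∀ k, ε k * ε k = 1) {s : ℝ}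
    (hx : ∀ k, 0 < ε k * (x k - s)) (hy : ∀ k, 0 < ε k * (y (Sum.inl k) - s))
    (hs : s < y (Sum.inr ())) :
    ∑ k, r k / (ε k * (x k - s)) < ∑ j, y j - ∑ k, x k - s := by
  have h0 (k) : x k ≠ s := fun h => by simpa [h] using hx k
  have h1 := h.prod_eq hε h0
  have hpos : 0 < (∏ k, (x k - s)) * ∏ j, (y j - s) := by
    rw [Fintype.prod_sum_type, ← mul_assoc, ← Finset.prod_mul_distrib]
    refine mul_pos (Finset.prod_pos fun k _ => ?_) (by simpa using hs)
    have := mul_pos (hx k) (hy k)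
    have h2 : ε k * (x k - s) * (ε k * (y (Sum.inl k) - s)) = (x k - s) * (y (Sum.inl k) - s) := by
      linear_combination ((x k - s) * (y (Sum.inl k) - s)) * hε k
    rwa [h2] at this
  rw [h1, ← mul_assoc] at hpos
  exact sub_pos.1 (pos_of_mul_pos_right hpos (mul_self_nonneg _))

open Filter Topology in
/-- Solvability of the secular identity passes to limits inside a fixed spectral gap. -/
lemma exists_secular_of_tendsto {K : Type*} [Fintype K] [DecidableEq K] {ε x : K → ℝ}
    {y : K ⊕ Unit → ℝ} (hε : ∀ k, ε k * ε k = 1) {s : ℝ} {X : ℕ → K → ℝ}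
    {Y : ℕ → K ⊕ Unit → ℝ} (hX : Tendsto X atTop (𝓝 x)) (hY : Tendsto Y atTop (𝓝 y))
    (hXs : ∀ n k, 0 < ε k * (X n k - s)) (hYs : ∀ n k, 0 < ε k * (Y n (Sum.inl k) - s))
    (hs : ∀ n, s < Y n (Sum.inr ()))
    (h : ∀ n, ∃ r : K → ℝ, (∀ k, 0 ≤ r k) ∧ Secular ε (X n) (Y n) r) :
    ∃ r : K → ℝ, (∀ k, 0 ≤ r k) ∧ Secular ε x y r := by
  choose r hr0 hr using h
  have hXk (k) := tendsto_pi_nhds.1 hX k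
  have hYk (k) := tendsto_pi_nhds.1 hY k
  have hcl : Tendsto (fun n => ∑ j, Y n j - ∑ k, X n k) atTop (𝓝 (∑ j, y j - ∑ k, x k)) :=
    (tendsto_finsetSum _ fun j _ => hYk j).sub (tendsto_finsetSum _ fun k _ => hXk k)
  have hbd (k) : ∃ R, ∀ n, r n k ≤ R := by
    have hlim := (((hcl.sub_const s)).mul (((hXk k).sub_const s).const_mul (ε k))).bddAbove_range
    obtain ⟨R, hR⟩ := hlim
    refine ⟨R, fun n => le_trans ?_ (hR (Set.mem_range_self n))⟩
    have h1 := ((hr n).sum_div_lt hε (hXs n) (hYs n) (hs n)).le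
    have h2 := (Finset.single_le_sum (f := fun k => r n k / (ε k * (X n k - s)))
      (fun m _ => div_nonneg (hr0 n m) (hXs n m).le) (Finset.mem_univ k)).trans h1
    exact (div_le_iff₀ (hXs n k)).1 h2
  choose R hR using hbd
  obtain ⟨r', hr', φ, hφ, hlim⟩ := (isCompact_Icc (a := (0 : K → ℝ)) (b := R)).tendsto_subseq
    (x := r) fun n => ⟨fun k => hr0 n k, fun k => hR k n⟩
  have hrk (k) := tendsto_pi_nhds.1 hlim k
  refine ⟨r', hr'.1, fun t => ?_⟩
  have hφ' := hφ.tendsto_atTop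
  refine tendsto_nhds_unique
    (tendsto_finsetProd _ fun j _ => ((hYk j).comp hφ').sub_const t) ?_
  have hR : Tendsto (fun n => (∑ j, Y (φ n) j - ∑ k, X (φ n) k - t) * ∏ k, (X (φ n) k - t) -
      ∑ k, ε k * r (φ n) k * ∏ m ∈ Finset.univ.erase k, (X (φ n) m - t)) atTop
      (𝓝 ((∑ j, y j - ∑ k, x k - t) * ∏ k, (x k - t) -
        ∑ k, ε k * r' k * ∏ m ∈ Finset.univ.erase k, (x m - t))) :=
    (((hcl.comp hφ').sub_const t).mul
      (tendsto_finsetProd _ fun k _ => ((hXk k).comp hφ').sub_const t)).sub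
      (tendsto_finsetSum _ fun k _ => ((hrk k).const_mul (ε k)).mul
        (tendsto_finsetProd _ fun m _ => ((hXk m).comp hφ').sub_const t))
  exact hR.congr fun n => (hr (φ n) t).symm

/-- A solution of the secular identity yields an arrowhead matrix, and hence a pseudo-unitary
matrix moving `diag(ε y)` to a Hermitian matrix with principal block `diag(ε x)`. -/
lemma exists_pseudoUnitary_of_secular {K : Type*} [Fintype K] [DecidableEq K] {ε x : K → ℝ}
    {y : K ⊕ Unit → ℝ} {r : K → ℝ} (hr : ∀ k, 0 ≤ r k) (h : Secular ε x y r)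
    (hε : ∀ k, ε k * ε k = 1) {s : ℝ}
    (hx : ∀ k, 0 < ε k * (x k - s)) (hy : ∀ k, 0 < ε k * (y (Sum.inl k) - s))
    (hs : s < y (Sum.inr ())) :
    ∃ g : Matrix (K ⊕ Unit) (K ⊕ Unit) ℂ, IsUnit g ∧
      g * diagonal (fun j => ((Sum.elim ε 1 j : ℝ) : ℂ)) * gᴴ =
        diagonal (fun j => ((Sum.elim ε 1 j : ℝ) : ℂ)) ∧
      (g * diagonal (fun j => ((Sum.elim ε 1 j * y j : ℝ) : ℂ)) * gᴴ).submatrix Sum.inl Sum.inl =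
        diagonal fun k => ((ε k * x k : ℝ) : ℂ) := by
  set c := ∑ j, y j - ∑ k, x k with hc
  set d : K → ℝ := fun k => ε k * (x k - s) with hd
  set δ := c - s - ∑ k, r k / d k with hδ
  have hδ0 : 0 < δ := sub_pos.2 (h.sum_div_lt hε hx hy hs)
  let b : Matrix K Unit ℂ := of fun k _ => ((√(r k) : ℝ) : ℂ)
  let H : Matrix (K ⊕ Unit) (K ⊕ Unit) ℂ :=
    fromBlocks (diagonal fun k => ((ε k * x k : ℝ) : ℂ)) b bᵀ (of fun _ _ => (c : ℂ))
  let B : Matrix (K ⊕ Unit) (K ⊕ Unit) ℂ :=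
    fromBlocks (diagonal fun k => ((√(d k) : ℝ) : ℂ)) 0
      (of fun _ k => ((√(r k) / √(d k) : ℝ) : ℂ)) (of fun _ _ => ((√δ : ℝ) : ℂ))
  have hd0 (k) : √(d k) ≠ 0 := (Real.sqrt_pos.2 (hx k)).ne'
  have hBdet : B.det ≠ 0 := by
    rw [det_fromBlocks_zero₁₂, det_diagonal]
    refine mul_ne_zero (Finset.prod_ne_zero_iff.2 fun k _ => by exact_mod_cast hd0 k) ?_
    simpa using (Real.sqrt_pos.2 hδ0).ne'
  have hJ : diagonal (fun j => ((Sum.elim ε 1 j : ℝ) : ℂ)) =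
      fromBlocks (diagonal fun k => (ε k : ℂ)) 0 0 (1 : Matrix Unit Unit ℂ) := by
    rw [← diagonal_one, fromBlocks_diagonal]
    congr 1
    ext j
    cases j <;> simp
  have hH : H = B * Bᴴ + (s : ℂ) • diagonal fun j => ((Sum.elim ε 1 j : ℝ) : ℂ) := by
    rw [hJ, fromBlocks_smul, fromBlocks_conjTranspose, fromBlocks_multiply, fromBlocks_add]
    simp only [H, fromBlocks_inj]
    have hdd (k) : √(d k) * √(d k) = ε k * (x k - s) := Real.mul_self_sqrt (hx k).le
    have hrd (k) : √(r k) / √(d k) * √(d k) = √(r k) := div_mul_cancel₀ _ (hd0 k)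
    refine ⟨?_, ?_, ?_, ?_⟩
    · rw [diagonal_conjTranspose, diagonal_mul_diagonal, Matrix.zero_mul, add_zero, ← diagonal_smul,
        diagonal_add]
      congr 1
      ext k
      have : ε k * x k = √(d k) * √(d k) + s * ε k := by linear_combination -hdd k
      rw [this]
      simp
    · ext k u
      rw [show b k u = ((√(r k) / √(d k) * √(d k) : ℝ) : ℂ) by rw [hrd]; rfl]
      simp [mul_comm]
    · ext u k
      rw [show bᵀ u k = ((√(r k) / √(d k) * √(d k) : ℝ) : ℂ) by rw [hrd]; rfl]
      simp [diagonal_conjTranspose]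
    · ext u v
      have : c = ∑ k, √(r k) / √(d k) * (√(r k) / √(d k)) + √δ * √δ + s := by
        have h1 : ∑ k, √(r k) / √(d k) * (√(r k) / √(d k)) = ∑ k, r k / d k :=
          Finset.sum_congr rfl fun k _ => by
            rw [div_mul_div_comm, Real.mul_self_sqrt (hr k), Real.mul_self_sqrt (hx k).le]
        rw [h1, Real.mul_self_sqrt hδ0.le, hδ]
        ring
      simp only [of_apply]
      rw [this]
      simp [mul_apply]
  obtain ⟨g, hg, hgJ, hgH⟩ := exists_pseudoUnitary_diagonalization (ε := Sum.elim ε 1) (y := y)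
    (s := s) (H := H) (S := (Set.range x)ᶜ) (by rintro (k | k) <;> simp [hε])
    (by rintro (k | k) <;> simp [hy, hs]) ((isUnit_iff_isUnit_det B).2 (IsUnit.mk0 _ hBdet)) hH
    (Set.finite_range x).infinite_compl (fun t ht => by
      have ht' (k) : x k ≠ t := fun hk => ht ⟨k, hk⟩
      have hw (k) : ((ε k * (x k - t) : ℝ) : ℂ) ≠ 0 := by
        exact_mod_cast mul_ne_zero (fun h0 => by simpa [h0] using hε k) (sub_ne_zero.2 (ht' k))
      have hHt : H - (t : ℂ) • diagonal (fun j => ((Sum.elim ε 1 j : ℝ) : ℂ)) =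
          fromBlocks (diagonal fun k => ((ε k * (x k - t) : ℝ) : ℂ)) b bᵀ
            (of fun _ _ => ((c - t : ℝ) : ℂ)) := by
        rw [hJ, fromBlocks_smul, sub_eq_add_neg, fromBlocks_neg, fromBlocks_add]
        simp only [fromBlocks_inj]
        refine ⟨?_, by simp, by simp, by ext; simp [sub_eq_add_neg]⟩
        rw [← sub_eq_add_neg, ← diagonal_smul, diagonal_sub]
        congr 1
        ext k
        simp
        ring
      let I : Invertible (diagonal fun k => ((ε k * (x k - t) : ℝ) : ℂ)) :=
        ⟨diagonal fun k => ((ε k * (x k - t) : ℝ) : ℂ)⁻¹,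
          by simp only [diagonal_mul_diagonal, inv_mul_cancel₀ (hw _), diagonal_one],
          by simp only [diagonal_mul_diagonal, mul_inv_cancel₀ (hw _), diagonal_one]⟩
      have hI : ⅟(diagonal fun k => ((ε k * (x k - t) : ℝ) : ℂ)) =
        diagonal fun k => ((ε k * (x k - t) : ℝ) : ℂ)⁻¹ := rfl
      have hent : ((of fun _ _ => ((c - t : ℝ) : ℂ)) - bᵀ *
          (diagonal fun k => ((ε k * (x k - t) : ℝ) : ℂ)⁻¹) * b : Matrix Unit Unit ℂ) () () =
          ((c - t - ∑ k, r k / (ε k * (x k - t)) : ℝ) : ℂ) := by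
        have h1 : ∑ k, r k / (ε k * (x k - t)) =
            ∑ k, √(r k) * (ε k * (x k - t))⁻¹ * √(r k) := Finset.sum_congr rfl fun k _ => by
          rw [mul_right_comm, Real.mul_self_sqrt (hr k), div_eq_mul_inv]
        rw [h1]
        rw [Matrix.sub_apply, mul_apply]
        simp only [mul_diagonal]
        simp [b]
      rw [hHt, det_fromBlocks₁₁, hI, det_diagonal, det_unique]
      refine (congrArg (_ * ·) hent).trans ?_
      norm_cast
      rw [Finset.prod_mul_distrib, mul_assoc, ← h.prod_eq hε ht', Finset.prod_mul_distrib,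
        Fintype.prod_sum_type (Sum.elim ε 1)]
      simp)
  refine ⟨g, hg, hgJ, ?_⟩
  rw [hgH]
  rfl

/-- The index set of `U(p+1,q)` as that of `U(p,q)` together with the deleted index. -/
noncomputable def splitEquiv (p q : ℕ) : Fin (p + q) ⊕ Unit ≃ Fin (p + 1 + q) :=
  Equiv.ofBijective (Sum.elim (embed p q) fun _ => ⟨p, by omega⟩) <| by
    have hne (k : Fin (p + q)) : embed p q k ≠ ⟨p, by omega⟩ := fun h => by
      have := congrArg Fin.val h
      rw [embed_val] at this
      split_ifs at this <;> simp at this <;> omega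
    refine (Fintype.bijective_iff_injective_and_card _).2 ⟨?_, by simp; omega⟩
    rintro (k | k) (m | m) h
    · exact congrArg _ (embed_injective p q h)
    · exact absurd h (hne k)
    · exact absurd h.symm (hne m)
    · rfl

lemma embed_strictMono (p q : ℕ) : StrictMono (embed p q) := by
  intro i j h
  rw [Fin.lt_def] at h ⊢
  rw [embed_val, embed_val]
  split_ifs <;> omega

lemma sgn_mul_pos {p k : ℕ} {z : ℝ} (h1 : k < p → 0 < z) (h2 : p ≤ k → z < 0) :
    0 < sgn p k * z := by
  unfold sgn
  split_ifs with h
  · simpa using h1 h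
  · simpa using h2 (not_lt.1 h)

open Filter Topology in
lemma exists_secular_of_interlaces {p q : ℕ} {y : Fin (p + 1 + q) → ℝ} {x : Fin (p + q) → ℝ}
    (hx : Antitone x) (hI : Interlaces p q y x) {s : ℝ}
    (hys : ∀ j : Fin (p + 1 + q), 0 < sgn (p + 1) j * (y j - s))
    (hxs : ∀ k : Fin (p + q), 0 < sgn p k * (x k - s)) :
    ∃ r : Fin (p + q) → ℝ, (∀ k, 0 ≤ r k) ∧
      Secular (fun k : Fin (p + q) => sgn p k) x (y ∘ splitEquiv p q) r := by
  -- spread the interlacing chain apart, away from the gap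
  let Y (n : ℕ) (j : Fin (p + 1 + q)) : ℝ := y j - 1 / ((n : ℝ) + 1) * ((j : ℕ) - p - 1 / 2)
  let X (n : ℕ) (k : Fin (p + q)) : ℝ := x k - 1 / ((n : ℝ) + 1) * ((embed p q k : ℕ) - p)
  have hδ (n : ℕ) : 0 < 1 / ((n : ℝ) + 1) := Nat.one_div_pos_of_nat
  have hlim (a b : ℝ) : Tendsto (fun n : ℕ => a - 1 / ((n : ℝ) + 1) * b) atTop (𝓝 a) := by
    simpa using (tendsto_one_div_add_atTop_nhds_zero_nat.mul_const b).const_sub a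
  have hlt (n k j) (h : j ≤ embed p q k) : X n k < Y n j := by
    have h1 := (hI k j).1 h
    have h2 : ((j : ℕ) : ℝ) ≤ (embed p q k : ℕ) := by exact_mod_cast h
    have h3 := mul_lt_mul_of_pos_left (show ((j : ℕ) : ℝ) - p - 1 / 2 < (embed p q k : ℕ) - p by
      linarith) (hδ n)
    simp only [X, Y]
    linarith
  have hgt (n k j) (h : embed p q k < j) : Y n j < X n k := by
    have h1 := (hI k j).2 h
    have h2 : ((embed p q k : ℕ) : ℝ) + 1 ≤ (j : ℕ) := by exact_mod_cast h
    have h3 := mul_lt_mul_of_pos_left (show ((embed p q k : ℕ) : ℝ) - p < (j : ℕ) - p - 1 / 2 by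
      linarith) (hδ n)
    simp only [X, Y]
    linarith
  have hanti (n) : StrictAnti (X n) := fun k m h => by
    have h1 := hx h.le
    have h2 : ((embed p q k : ℕ) : ℝ) < (embed p q m : ℕ) := by
      exact_mod_cast embed_strictMono p q h
    have h3 := mul_lt_mul_of_pos_left (sub_lt_sub_right h2 (p : ℝ)) (hδ n)
    simp only [X]
    linarith
  have hYs (n) (j : Fin (p + 1 + q)) : 0 < sgn (p + 1) j * (Y n j - s) := by
    have h0 : 0 ≤ 1 / ((n : ℝ) + 1) * -(sgn (p + 1) j * ((j : ℕ) - p - 1 / 2)) := by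
      refine mul_nonneg (hδ n).le ?_
      unfold sgn
      split_ifs with h
      · have : ((j : ℕ) : ℝ) ≤ p := by exact_mod_cast Nat.lt_succ_iff.1 h
        linarith
      · have : (p : ℝ) + 1 ≤ (j : ℕ) := by exact_mod_cast not_lt.1 h
        linarith
    simp only [Y]
    linarith [hys j]
  have hXs (n) (k : Fin (p + q)) : 0 < sgn p k * (X n k - s) := by
    have h0 : 0 ≤ 1 / ((n : ℝ) + 1) * -(sgn p k * ((embed p q k : ℕ) - p)) := by
      refine mul_nonneg (hδ n).le ?_
      rw [embed_val]
      unfold sgn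
      split_ifs with h
      · have : ((k : ℕ) : ℝ) < p := by exact_mod_cast h
        linarith
      · have : (p : ℝ) ≤ (k : ℕ) := by exact_mod_cast not_lt.1 h
        push_cast
        linarith
    simp only [X]
    linarith [hxs k]
  refine exists_secular_of_tendsto (s := s) (X := X) (Y := fun n => Y n ∘ splitEquiv p q)
    (fun k => sgn_mul_self p k) (tendsto_pi_nhds.2 fun k => hlim _ _)
    (tendsto_pi_nhds.2 fun j => hlim _ _) hXs (fun n k => ?_) (fun n => ?_) fun n => ?_
  · rw [← sgn_embed]
    exact hYs n (embed p q k)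
  · have : s < Y n ⟨p, by omega⟩ := by simpa [sgn] using hYs n ⟨p, by omega⟩
    exact this
  · refine exists_secular_of_strict (fun k => sgn_mul_self p k) (hanti n).injective
      (fun k m hmk => ?_) fun k => ?_
    · rcases hmk.lt_or_gt with h | h
      · exact div_nonneg_of_nonpos
          (sub_nonpos.2 (hlt n k (embed p q m) (embed_strictMono p q h).le).le)
          (sub_nonpos.2 (hanti n h).le)
      · exact div_nonneg (sub_nonneg.2 (hgt n k (embed p q m) (embed_strictMono p q h)).le)
          (sub_nonneg.2 (hanti n h).le)
    · refine mul_nonpos_of_nonneg_of_nonpos (sgn_mul_pos (fun h => ?_) fun h => ?_).le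
        (sub_nonpos.2 (hlt n k (embed p q k) le_rfl).le)
      · refine sub_pos.2 (hgt n k ⟨p, by omega⟩ (Fin.lt_def.2 ?_))
        rw [embed_val, if_pos h]
        exact h
      · refine sub_neg.2 (hlt n k ⟨p, by omega⟩ (Fin.le_def.2 ?_))
        rw [embed_val, if_neg h.not_gt]
        exact h.trans (Nat.le_succ _)

lemma exists_projMat_of_interlaces {p q : ℕ} (hq : 1 ≤ q) {y : Fin (p + 1 + q) → ℝ}
    {x : Fin (p + q) → ℝ} (hy : y ∈ Chol (p + 1) q) (hx : x ∈ Chol p q)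
    (hI : Interlaces p q y x) :
    ∃ g ∈ Upq (p + 1) q, projMat p q (g * dmat y * g⁻¹) = dmat x := by
  have hya := Chol.antitone hy
  obtain ⟨s, hs1, hs2⟩ := exists_between
    (hy.2 ⟨p, by omega⟩ ⟨p + 1, by omega⟩ (Nat.lt_succ_self p) le_rfl)
  have hys (j : Fin (p + 1 + q)) : 0 < sgn (p + 1) j * (y j - s) :=
    sgn_mul_pos
      (fun h => sub_pos.2 (hs2.trans_le (hya (Fin.le_def.2 (Nat.lt_succ_iff.1 h)))))
      fun h => sub_neg.2 ((hya (Fin.le_def.2 h)).trans_lt hs1)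
  have hxs (k : Fin (p + q)) : 0 < sgn p k * (x k - s) := by
    refine sgn_mul_pos (fun h => sub_pos.2 (hs2.trans_le ((hI k _).2 (Fin.lt_def.2 ?_))))
      fun h => sub_neg.2 (((hI k _).1 (Fin.le_def.2 ?_)).trans_lt hs1)
    · rw [embed_val, if_pos h]
      exact h
    · rw [embed_val, if_neg h.not_gt]
      exact Nat.succ_le_succ h
  obtain ⟨r, hr, hsec⟩ := exists_secular_of_interlaces (Chol.antitone hx) hI hys hxs
  obtain ⟨g, hg, hgJ, hgH⟩ := exists_pseudoUnitary_of_secular hr hsec (fun k => sgn_mul_self p k)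
    hxs (fun k => by rw [← sgn_embed]; exact hys (embed p q k))
    (show s < y ⟨p, by omega⟩ from hs2)
  set φ := splitEquiv p q with hφ
  have hε (j) : Sum.elim (fun k : Fin (p + q) => sgn p k) 1 j = sgn (p + 1) (φ j) := by
    rcases j with k | k
    · exact (sgn_embed p q k).symm
    · exact (if_pos (Nat.lt_succ_self p)).symm
  simp only [hε] at hgJ hgH
  have hre (z : Fin (p + 1 + q) → ℂ) : g.submatrix φ.symm φ.symm * diagonal z *
      (g.submatrix φ.symm φ.symm)ᴴ =
      (g * diagonal (fun j => z (φ j)) * gᴴ).submatrix φ.symm φ.symm := by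
    have : diagonal z = (diagonal fun j => z (φ j)).submatrix φ.symm φ.symm := by
      rw [submatrix_diagonal_equiv]
      congr 1
      ext j
      simp
    rw [this, conjTranspose_submatrix, submatrix_mul_equiv, submatrix_mul_equiv]
  have hU : g.submatrix φ.symm φ.symm ∈ Upq (p + 1) q := by
    refine ⟨(isUnit_submatrix_equiv _ _).2 hg, ?_⟩
    rw [Ipq_eq, hre, hgJ, submatrix_diagonal_equiv]
    congr 1
    ext j
    simp
  refine ⟨_, hU, (projMat_eq_dmat_iff hU y x).2 ?_⟩
  rw [hre, submatrix_submatrix]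
  have he : ⇑φ.symm ∘ embed p q = Sum.inl := by
    ext k : 1
    exact (Equiv.symm_apply_eq φ).2 rfl
  rw [he]
  exact hgH

/-- `Π` is cut out of the product of the chambers by the interlacing inequalities. -/
lemma mem_PiHol_iff {p q : ℕ} (hq : 1 ≤ q) (yx : (Fin (p + 1 + q) → ℝ) × (Fin (p + q) → ℝ)) :
    yx ∈ PiHol p q ↔
      yx.1 ∈ Chol (p + 1) q ∧ yx.2 ∈ Chol p q ∧ Interlaces p q yx.1 yx.2 :=
  ⟨fun ⟨hy, hx, _, hg, h⟩ => ⟨hy, hx, interlaces_of_projMat hq hy hx hg h⟩,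
    fun ⟨hy, hx, hI⟩ => ⟨hy, hx, exists_projMat_of_interlaces hq hy hx hI⟩⟩

lemma convex_Chol (p q : ℕ) : Convex ℝ (Chol p q) := by
  refine convex_iff_forall_pos.2 fun x hx y hy a b ha hb _ => ⟨fun i j h1 h2 => ?_,
    fun i j h1 h2 => ?_⟩
  · exact add_le_add (mul_le_mul_of_nonneg_left (hx.1 i j h1 h2) ha.le)
      (mul_le_mul_of_nonneg_left (hy.1 i j h1 h2) hb.le)
  · exact add_lt_add (mul_lt_mul_of_pos_left (hx.2 i j h1 h2) ha)
      (mul_lt_mul_of_pos_left (hy.2 i j h1 h2) hb)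

lemma smul_mem_Chol {p q : ℕ} {t : ℝ} (ht : 0 < t) {x : Fin (p + q) → ℝ} (hx : x ∈ Chol p q) :
    t • x ∈ Chol p q :=
  ⟨fun i j h1 h2 => mul_le_mul_of_nonneg_left (hx.1 i j h1 h2) ht.le,
    fun i j h1 h2 => mul_lt_mul_of_pos_left (hx.2 i j h1 h2) ht⟩

lemma isClosed_interlaces (p q : ℕ) :
    IsClosed {yx : (Fin (p + 1 + q) → ℝ) × (Fin (p + q) → ℝ) | Interlaces p q yx.1 yx.2} := by
  simp only [Interlaces, Set.ofPred_forall, Set.ofPred_and]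
  refine isClosed_iInter fun k => isClosed_iInter fun j => IsClosed.inter ?_ ?_ <;>
    exact isClosed_iInter fun _ => isClosed_le (by fun_prop) (by fun_prop)

theorem statement2 (p q : ℕ) (hq : 1 ≤ q) (hpq : q ≤ p) :
    Convex ℝ (PiHol p q) ∧
    (∀ t : ℝ, 0 < t → ∀ yx ∈ PiHol p q, t • yx ∈ PiHol p q) ∧
    IsClosed ((Subtype.val :
        {yx : (Fin (p + 1 + q) → ℝ) × (Fin (p + q) → ℝ) //
          yx.1 ∈ Chol (p + 1) q ∧ yx.2 ∈ Chol p q} →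
        (Fin (p + 1 + q) → ℝ) × (Fin (p + q) → ℝ)) ⁻¹' PiHol p q) := by
  refine ⟨?_, fun t ht yx h => ?_, ?_⟩
  · refine convex_iff_forall_pos.2 fun u hu v hv a b ha hb hab => ?_
    rw [mem_PiHol_iff hq] at hu hv ⊢
    refine ⟨convex_Chol _ _ hu.1 hv.1 ha.le hb.le hab,
      convex_Chol _ _ hu.2.1 hv.2.1 ha.le hb.le hab, fun k j => ⟨fun h => ?_, fun h => ?_⟩⟩
    · exact add_le_add (mul_le_mul_of_nonneg_left ((hu.2.2 k j).1 h) ha.le)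
        (mul_le_mul_of_nonneg_left ((hv.2.2 k j).1 h) hb.le)
    · exact add_le_add (mul_le_mul_of_nonneg_left ((hu.2.2 k j).2 h) ha.le)
        (mul_le_mul_of_nonneg_left ((hv.2.2 k j).2 h) hb.le)
  · rw [mem_PiHol_iff hq] at h ⊢
    exact ⟨smul_mem_Chol ht h.1, smul_mem_Chol ht h.2.1, fun k j =>
      ⟨fun hj => mul_le_mul_of_nonneg_left ((h.2.2 k j).1 hj) ht.le,
        fun hj => mul_le_mul_of_nonneg_left ((h.2.2 k j).2 hj) ht.le⟩⟩
  · convert (isClosed_interlaces p q).preimage continuous_subtype_val using 1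
    ext ⟨yx, hyx⟩
    simp only [Set.mem_preimage, mem_PiHol_iff hq, Set.mem_ofPred_eq, hyx.1, hyx.2, true_and]
end

section
/- If X belongs to the interior of C(p,q) relative to 𝔲(p,q), then the stabilizer {g ∈ U(p,q) : g · X = X · g} is a compact subset of M_n(ℂ). -/
open Matrix Complex Pointwise

/-- The Lie algebra `𝔲(p,q)`. -/
def upqLie (p q : ℕ) : Set (Matrix (Fin (p + q)) (Fin (p + q)) ℂ) :=
  {X | X * Ipq p q + Ipq p q * X.conjTranspose = 0}

/-- The invariant cone `C(p,q) ⊆ 𝔲(p,q)`. -/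
def Cpq (p q : ℕ) : Set (Matrix (Fin (p + q)) (Fin (p + q)) ℂ) :=
  {X | X ∈ upqLie p q ∧ ∀ g ∈ Upq p q, 0 ≤ ((g * X * g⁻¹ * Ipq p q).trace).im}

/-- The interior of `C(p,q)` relative to the subspace `𝔲(p,q)`. -/
def interiorC (p q : ℕ) : Set (Matrix (Fin (p + q)) (Fin (p + q)) ℂ) :=
  {X | ∃ h : X ∈ upqLie p q,
    (⟨X, h⟩ : upqLie p q) ∈ interior (Subtype.val ⁻¹' Cpq p q)}

lemma Ipq_conjTranspose (p q : ℕ) : (Ipq p q)ᴴ = Ipq p q := by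
  rw [Ipq, diagonal_conjTranspose]
  congr 1
  ext i
  simp only [Pi.star_apply]
  split_ifs <;> simp

lemma mul_eq_one_of_mul_Ipq_mul_conjTranspose {p q : ℕ}
    {g : Matrix (Fin (p + q)) (Fin (p + q)) ℂ} (h : g * Ipq p q * gᴴ = Ipq p q) :
    g * (Ipq p q * gᴴ * Ipq p q) = 1 := by
  rw [← Ipq_mul_self p q, ← mul_assoc, ← mul_assoc, h]

lemma mem_Upq_iff {p q : ℕ} {g : Matrix (Fin (p + q)) (Fin (p + q)) ℂ} :
    g ∈ Upq p q ↔ g * Ipq p q * gᴴ = Ipq p q :=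
  ⟨fun h => h.2, fun h =>
    ⟨IsUnit.of_mul_eq_one _ (mul_eq_one_of_mul_Ipq_mul_conjTranspose h), h⟩⟩

lemma inv_eq_of_mem_Upq {p q : ℕ} {g : Matrix (Fin (p + q)) (Fin (p + q)) ℂ}
    (h : g ∈ Upq p q) : g⁻¹ = Ipq p q * gᴴ * Ipq p q :=
  inv_eq_right_inv (mul_eq_one_of_mul_Ipq_mul_conjTranspose h.2)

lemma isClosed_stabilizer (p q : ℕ) (X : Matrix (Fin (p + q)) (Fin (p + q)) ℂ) :
    IsClosed {g | g ∈ Upq p q ∧ g * X = X * g} := by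
  simp only [mem_Upq_iff]
  exact (isClosed_eq (by fun_prop) (by fun_prop)).inter (isClosed_eq (by fun_prop) (by fun_prop))

lemma sub_smul_Ipq_mem_upqLie {p q : ℕ} {X : Matrix (Fin (p + q)) (Fin (p + q)) ℂ}
    (hX : X ∈ upqLie p q) (t : ℝ) : X - ((t : ℂ) * I) • Ipq p q ∈ upqLie p q := by
  have hX : X * Ipq p q + Ipq p q * Xᴴ = 0 := hX
  change _ * _ + _ * _ᴴ = 0
  rw [conjTranspose_sub, conjTranspose_smul, Ipq_conjTranspose, sub_mul, mul_sub, smul_mul_assoc,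
    mul_smul_comm, Ipq_mul_self]
  simp only [star_mul', star_def, conj_I, conj_ofReal, mul_neg, neg_smul, sub_neg_eq_add]
  rw [← hX]
  abel

lemma exists_pos_sub_smul_Ipq_mem_Cpq {p q : ℕ} {X : Matrix (Fin (p + q)) (Fin (p + q)) ℂ}
    (hX : X ∈ interiorC p q) :
    ∃ t : ℝ, 0 < t ∧ X - ((t : ℂ) * I) • Ipq p q ∈ Cpq p q := by
  obtain ⟨hXu, hXi⟩ := hX
  let f : ℝ → upqLie p q := fun t => ⟨X - ((t : ℂ) * I) • Ipq p q, sub_smul_Ipq_mem_upqLie hXu t⟩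
  have hf : Continuous f := Continuous.subtype_mk (by fun_prop) _
  have hf0 : f 0 = ⟨X, hXu⟩ := by simp [f]
  have hnhds : ∀ᶠ t in nhds (0 : ℝ), f t ∈ Subtype.val ⁻¹' Cpq p q :=
    hf.continuousAt.eventually_mem (by rw [hf0]; exact mem_interior_iff_mem_nhds.1 hXi)
  obtain ⟨t, ht, ht0⟩ :=
    ((hnhds.filter_mono nhdsWithin_le_nhds).and (self_mem_nhdsWithin (s := Set.Ioi 0))).exists
  exact ⟨t, ht0, ht⟩

lemma trace_mul_conjTranspose_eq_sum {n : Type*} [Fintype n] (g : Matrix n n ℂ) :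
    (g * gᴴ).trace = ((∑ i, ∑ j, ‖g i j‖ ^ 2 : ℝ) : ℂ) := by
  simp [trace, mul_apply, mul_conj, normSq_eq_norm_sq]

lemma mul_sum_norm_sq_le_of_mem_stabilizer {p q : ℕ}
    {X g : Matrix (Fin (p + q)) (Fin (p + q)) ℂ} {t : ℝ}
    (hX : X - ((t : ℂ) * I) • Ipq p q ∈ Cpq p q) (hg : g ∈ Upq p q) (hgX : g * X = X * g) :
    t * ∑ i, ∑ j, ‖g i j‖ ^ 2 ≤ ((X * Ipq p q).trace).im := by
  have h := hX.2 g hg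
  have hXg : g * X * g⁻¹ = X := by
    rw [hgX, mul_assoc, mul_nonsing_inv g ((isUnit_iff_isUnit_det g).1 hg.1), mul_one]
  have hJ : g * Ipq p q * g⁻¹ * Ipq p q = g * gᴴ := by
    rw [inv_eq_of_mem_Upq hg]
    simp only [mul_assoc, Ipq_mul_self, mul_one]
    rw [← mul_assoc (Ipq p q) (Ipq p q), Ipq_mul_self, one_mul]
  have hsplit : g * (X - ((t : ℂ) * I) • Ipq p q) * g⁻¹ * Ipq p q
      = X * Ipq p q - ((t : ℂ) * I) • (g * gᴴ) := by
    rw [mul_sub, sub_mul, sub_mul, hXg, mul_smul_comm, smul_mul_assoc, smul_mul_assoc, hJ]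
  rw [hsplit, trace_sub, trace_smul, trace_mul_conjTranspose_eq_sum, sub_im, smul_eq_mul,
    im_mul_ofReal] at h
  simpa using h

theorem statement4 (p q : ℕ) (hq : 1 ≤ q) (hpq : q ≤ p)
    (X : Matrix (Fin (p + q)) (Fin (p + q)) ℂ) (hX : X ∈ interiorC p q) :
    IsCompact {g | g ∈ Upq p q ∧ g * X = X * g} := by
  obtain ⟨t, ht, htX⟩ := exists_pos_sub_smul_Ipq_mem_Cpq hX
  set R : ℝ := ((X * Ipq p q).trace).im / t
  have hK : IsCompact (Set.univ.pi fun _ : Fin (p + q) => Set.univ.pi fun _ : Fin (p + q) =>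
      Metric.closedBall (0 : ℂ) √R) :=
    isCompact_univ_pi fun _ => isCompact_univ_pi fun _ => isCompact_closedBall _ _
  refine IsCompact.of_isClosed_subset hK (isClosed_stabilizer p q X) ?_
  rintro g ⟨hg, hgX⟩ i - j -
  rw [mem_closedBall_zero_iff]
  refine Real.le_sqrt_of_sq_le ?_
  calc ‖g i j‖ ^ 2 ≤ ∑ j, ‖g i j‖ ^ 2 :=
        Finset.single_le_sum (f := fun j => ‖g i j‖ ^ 2) (fun _ _ => by positivity)
          (Finset.mem_univ j)
    _ ≤ ∑ i, ∑ j, ‖g i j‖ ^ 2 :=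
        Finset.single_le_sum (f := fun i => ∑ j, ‖g i j‖ ^ 2) (fun _ _ => by positivity)
          (Finset.mem_univ i)
    _ ≤ R := by
        rw [le_div_iff₀' ht]
        exact mul_sum_norm_sq_le_of_mem_stabilizer htX hg hgX
end

section
/- If X ∈ 𝔲(p,q) and the stabilizer {g ∈ U(p,q) : g · X = X · g} is a compact subset of M_n(ℂ), then X is elliptic: there exist g ∈ U(p,q) and x ∈ ℝⁿ such that X = g · d_x · g⁻¹. -/
open Matrix Complex Pointwise

/-- Markov–Kakutani theorem for a single linear map in finite dimension. -/
theorem exists_fixedPoint_mem_closure_convexHull {E : Type*} [NormedAddCommGroup E]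
    [NormedSpace ℝ E] [FiniteDimensional ℝ E] {T : Set E} (hT : IsCompact T) (hne : T.Nonempty)
    (f : E →ₗ[ℝ] E) (hf : Set.MapsTo f T T) : ∃ x ∈ closure (convexHull ℝ T), f x = x := by
  have hfc : Continuous f := f.continuous_of_finiteDimensional
  have hK : IsCompact (closure (convexHull ℝ T)) := by
    have := FiniteDimensional.proper ℝ E
    exact (isBounded_convexHull.2 hT.isBounded).isCompact_closure
  obtain ⟨x₀, hx₀⟩ := hne
  have hit : ∀ k : ℕ, f^[k] x₀ ∈ T := fun k => hf.iterate k hx₀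
  obtain ⟨R, hR⟩ := hT.isBounded.exists_norm_le
  set u : ℕ → E := fun N => ((N : ℝ) + 1)⁻¹ • ∑ k ∈ Finset.range (N + 1), f^[k] x₀ with hu
  have huK : ∀ N, u N ∈ closure (convexHull ℝ T) := fun N => by
    refine subset_closure ?_
    rw [hu]
    simp only [Finset.smul_sum]
    refine (convex_convexHull ℝ T).sum_mem (fun _ _ => by positivity) ?_
      fun k _ => subset_convexHull ℝ T (hit k)
    simp only [Finset.sum_const, Finset.card_range, nsmul_eq_mul]
    push_cast
    field_simp
  have hdiff : Filter.Tendsto (fun N => f (u N) - u N) Filter.atTop (nhds 0) := by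
    have hb : ∀ N, ‖f (u N) - u N‖ ≤ 2 * R * (1 / ((N : ℝ) + 1)) := fun N => by
      have : f (u N) - u N = ((N : ℝ) + 1)⁻¹ • (f^[N + 1] x₀ - x₀) := by
        simp only [hu, map_smul, map_sum, ← smul_sub, ← Finset.sum_sub_distrib]
        congr 1
        have := Finset.sum_range_sub (fun k => f^[k] x₀) (N + 1)
        simpa only [Function.iterate_succ_apply', Function.iterate_zero, id] using this
      rw [this, norm_smul, Real.norm_of_nonneg (by positivity), mul_comm, one_div]
      gcongr
      exact (norm_sub_le _ _).trans (by linarith [hR _ (hit (N + 1)), hR _ hx₀])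
    refine squeeze_zero_norm hb ?_
    simpa using tendsto_one_div_add_atTop_nhds_zero_nat.const_mul (2 * R)
  obtain ⟨x, hx, φ, hφ, hlim⟩ := hK.tendsto_subseq huK
  refine ⟨x, hx, sub_eq_zero.1 (tendsto_nhds_unique ?_ (hdiff.comp hφ.tendsto_atTop))⟩
  exact ((hfc.tendsto x).comp hlim).sub hlim

/-- Two commuting Hermitian matrices are simultaneously unitarily diagonalizable. -/
theorem Matrix.IsHermitian.exists_simultaneous_diagonalization {n : Type*} [Fintype n]
    [DecidableEq n] {A B : Matrix n n ℂ} (hA : A.IsHermitian) (hB : B.IsHermitian)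
    (hAB : Commute A B) :
    ∃ (U : Matrix n n ℂ) (a b : n → ℝ), Uᴴ * U = 1 ∧
      A * U = U * diagonal (fun i => (a i : ℂ)) ∧ B * U = U * diagonal (fun i => (b i : ℂ)) := by
  have hA' := isSymmetric_toEuclideanLin_iff.2 hA
  have hB' := isSymmetric_toEuclideanLin_iff.2 hB
  have hc : Commute (toEuclideanLin A) (toEuclideanLin B) := by
    change toEuclideanLin A ∘ₗ toEuclideanLin B = toEuclideanLin B ∘ₗ toEuclideanLin A
    have := congrArg toEuclideanLin hAB.eq
    simpa using this
  classical
  have hint := LinearMap.IsSymmetric.directSum_isInternal_of_commute hA' hB' hc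
  have horth := LinearMap.IsSymmetric.orthogonalFamily_eigenspace_inf_eigenspace hA' hB'
  set v := hint.collectedBasis fun i => (stdOrthonormalBasis ℂ _).toBasis
  have hvo : Orthonormal ℂ v := DirectSum.IsInternal.collectedBasis_orthonormal horth hint
    fun i => by simp [(stdOrthonormalBasis ℂ _).orthonormal]
  let := FiniteDimensional.fintypeBasisIndex v
  let e := Fintype.equivOfCardEq (((Module.finrank_eq_card_basis v).symm.trans
    (finrank_euclideanSpace (𝕜 := ℂ) (ι := n))))
  have hmem : ∀ k, v k ∈ Module.End.eigenspace (toEuclideanLin A) k.1.2 ⊓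
      Module.End.eigenspace (toEuclideanLin B) k.1.1 := fun k => hint.collectedBasis_mem _ k
  have hvA : ∀ k, toEuclideanLin A (v k) = k.1.2 • v k := fun k =>
    Module.End.mem_eigenspace_iff.1 (hmem k).1
  have hvB : ∀ k, toEuclideanLin B (v k) = k.1.1 • v k := fun k =>
    Module.End.mem_eigenspace_iff.1 (hmem k).2
  have hre : ∀ {C : Matrix n n ℂ} (_ : (toEuclideanLin C).IsSymmetric) (k) (z : ℂ)
      (_ : toEuclideanLin C (v k) = z • v k), ((z.re : ℝ) : ℂ) = z := fun hC k z h => by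
    have := hC.conj_eigenvalue_eq_self
      (Module.End.hasEigenvalue_of_hasEigenvector
        ⟨Module.End.mem_eigenspace_iff.2 h, v.ne_zero k⟩)
    exact Complex.conj_eq_iff_re.1 this
  have hcol : ∀ {C : Matrix n n ℂ} (c : n → ℝ)
      (_ : ∀ j, toEuclideanLin C (v (e.symm j)) = (c j : ℂ) • v (e.symm j)),
      C * (of fun i j => v (e.symm j) i) =
        (of fun i j => v (e.symm j) i) * diagonal (fun i => (c i : ℂ)) := fun c h => by
    ext i j
    have := congrArg (fun w : EuclideanSpace ℂ n => w i) (h j)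
    simpa [mul_apply, mulVec, dotProduct, diagonal_apply, mul_comm] using this
  refine ⟨of fun i j => v (e.symm j) i, fun j => ((e.symm j).1.2).re,
    fun j => ((e.symm j).1.1).re, ?_, hcol _ fun j => ?_, hcol _ fun j => ?_⟩
  · ext i j
    have := orthonormal_iff_ite.1 hvo (e.symm i) (e.symm j)
    simp only [PiLp.inner_apply, RCLike.inner_apply, EmbeddingLike.apply_eq_iff_eq] at this
    simpa [mul_apply, one_apply, mul_comm] using this
  · rw [hre hA' _ _ (hvA _), hvA]
  · rw [hre hB' _ _ (hvB _), hvB]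

/-- One half of Sylvester's law of inertia. -/
theorem card_pos_le_of_diagonal_eq_mul_mul_conjTranspose {n : Type*} [Fintype n] [DecidableEq n]
    {s t : n → ℝ} {g : Matrix n n ℂ}
    (h : diagonal (fun i => (s i : ℂ)) = g * diagonal (fun i => (t i : ℂ)) * gᴴ) :
    Fintype.card {i // 0 < s i} ≤ Fintype.card {i // 0 < t i} := by
  have hform : ∀ v : n → ℂ, ∑ i, s i * normSq (v i) = ∑ i, t i * normSq ((gᴴ *ᵥ v) i) := by
    have key : ∀ (r : n → ℝ) (v : n → ℂ),
        star v ⬝ᵥ (diagonal (fun i => (r i : ℂ)) *ᵥ v) = ((∑ i, r i * normSq (v i) : ℝ) : ℂ) := by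
      intro r v
      simp only [dotProduct, mulVec_diagonal, Pi.star_apply]
      push_cast
      refine Finset.sum_congr rfl fun i _ => ?_
      rw [normSq_eq_conj_mul_self]
      simp only [RCLike.star_def]
      ring
    intro v
    have : star v ⬝ᵥ (diagonal (fun i => (s i : ℂ)) *ᵥ v) =
        star (gᴴ *ᵥ v) ⬝ᵥ (diagonal (fun i => (t i : ℂ)) *ᵥ (gᴴ *ᵥ v)) := by
      rw [h, star_mulVec, conjTranspose_conjTranspose, ← mulVec_mulVec, ← mulVec_mulVec,
        dotProduct_mulVec (star v)]
    rw [key, key] at this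
    exact_mod_cast this
  let ext : ({i // 0 < s i} → ℂ) →ₗ[ℂ] (n → ℂ) :=
    Function.ExtendByZero.linearMap ℂ Subtype.val
  let F : ({i // 0 < s i} → ℂ) →ₗ[ℂ] ({i // 0 < t i} → ℂ) :=
    LinearMap.funLeft ℂ ℂ Subtype.val ∘ₗ gᴴ.mulVecLin ∘ₗ ext
  have hF : Function.Injective F := by
    rw [injective_iff_map_eq_zero]
    intro w hw
    have hext : ∀ i : {i // 0 < s i}, ext w i = w i := fun i =>
      Subtype.val_injective.extend_apply w (0 : n → ℂ) i
    have hext0 : ∀ i, ¬ 0 < s i → ext w i = 0 := fun i hi =>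
      Function.extend_apply' w (0 : n → ℂ) i fun ⟨j, hj⟩ => hi (hj ▸ j.2)
    have hle : ∑ i, t i * normSq ((gᴴ *ᵥ ext w) i) ≤ 0 := by
      refine Finset.sum_nonpos fun i _ => ?_
      by_cases hi : 0 < t i
      · have : (gᴴ *ᵥ ext w) i = 0 := congrFun hw ⟨i, hi⟩
        simp [this]
      · exact mul_nonpos_of_nonpos_of_nonneg (not_lt.1 hi) (normSq_nonneg _)
    have hnn : ∀ i ∈ Finset.univ, 0 ≤ s i * normSq (ext w i) := fun i _ => by
      by_cases hi : 0 < s i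
      · exact mul_nonneg hi.le (normSq_nonneg _)
      · simp [hext0 i hi]
    have hz := (Finset.sum_eq_zero_iff_of_nonneg hnn).1
      (le_antisymm ((hform _).trans_le hle) (Finset.sum_nonneg hnn))
    funext i
    have := hz i (Finset.mem_univ _)
    rw [hext] at this
    simpa [i.2.ne'] using this
  simpa using LinearMap.finrank_le_finrank_of_injective hF

theorem exists_perm_of_diagonal_eq_mul_mul_conjTranspose {n : Type*} [Fintype n] [DecidableEq n]
    {s t : n → ℝ} {g : Matrix n n ℂ} (hg : IsUnit g)
    (h : diagonal (fun i => (s i : ℂ)) = g * diagonal (fun i => (t i : ℂ)) * gᴴ) :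
    ∃ σ : Equiv.Perm n, ∀ i, 0 < t (σ i) ↔ 0 < s i := by
  have hdet := (isUnit_iff_isUnit_det g).1 hg
  have hdet' := (isUnit_iff_isUnit_det gᴴ).1 hg.star
  have h' : diagonal (fun i => (t i : ℂ)) =
      g⁻¹ * diagonal (fun i => (s i : ℂ)) * (g⁻¹)ᴴ := by
    rw [h, conjTranspose_nonsing_inv, mul_assoc g, nonsing_inv_mul_cancel_left _ _ hdet,
      mul_nonsing_inv_cancel_right _ _ hdet']
  have e := Fintype.equivOfCardEq <|
    (card_pos_le_of_diagonal_eq_mul_mul_conjTranspose h).antisymm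
      (card_pos_le_of_diagonal_eq_mul_mul_conjTranspose h')
  refine ⟨e.extendSubtype, fun i => ⟨fun hi => ?_, e.extendSubtype_mem i⟩⟩
  by_contra hs
  exact e.extendSubtype_not_mem i hs hi

section
open scoped ComplexOrder

theorem Matrix.isClosed_setOf_posSemidef {n : Type*} [Fintype n] :
    IsClosed {M : Matrix n n ℂ | M.PosSemidef} := by
  simp only [posSemidef_iff_dotProduct_mulVec, Set.ofPred_and, Set.ofPred_forall]
  refine IsClosed.inter (isClosed_eq (by fun_prop) continuous_id) (isClosed_iInter fun v => ?_)
  exact isClosed_le continuous_const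
    (continuous_const.dotProduct (continuous_id.matrix_mulVec continuous_const))

theorem Matrix.convex_setOf_posSemidef {n : Type*} [Fintype n] :
    Convex ℝ {M : Matrix n n ℂ | M.PosSemidef} :=
  fun _ hM _ hN _ _ ha hb _ => (PosSemidef.smul hM ha).add (PosSemidef.smul hN hb)

/-- For a symmetry `J`, the inequalities `2 t ≤ Q + t² J Q J` force `Q` to be definite. -/
theorem Matrix.posDef_of_forall_posSemidef {n : Type*} [Fintype n] [DecidableEq n]
    {J Q : Matrix n n ℂ}
    (h : ∀ t : ℝ, (Q + t ^ 2 • (J * Q * J) - (2 * t) • (1 : Matrix n n ℂ)).PosSemidef) :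
    Q.PosDef := by
  have hQ : Q.PosSemidef := by simpa using h 0
  refine .of_dotProduct_mulVec_pos hQ.1 fun v hv => ?_
  have hγ : 0 < star v ⬝ᵥ v := dotProduct_star_self_pos_iff.2 hv
  have h0 := hQ.dotProduct_mulVec_nonneg v
  have ht : ∀ t : ℝ, 0 ≤ (star v ⬝ᵥ (Q *ᵥ v)).re +
      t ^ 2 * (star v ⬝ᵥ ((J * Q * J) *ᵥ v)).re - 2 * t * (star v ⬝ᵥ v).re := fun t => by
    have := (Complex.le_def.1 ((h t).dotProduct_mulVec_nonneg v)).1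
    simpa only [sub_mulVec, add_mulVec, smul_mulVec, one_mulVec, dotProduct_sub, dotProduct_add,
      dotProduct_smul, Complex.sub_re, Complex.add_re, Complex.smul_re, smul_eq_mul,
      Complex.zero_re] using this
  refine lt_of_le_of_ne h0 fun hzero => ?_
  rw [← hzero] at ht
  have hγ' := (Complex.lt_def.1 hγ).1
  generalize (star v ⬝ᵥ v).re = γ at ht hγ'
  generalize (star v ⬝ᵥ ((J * Q * J) *ᵥ v)).re = β at ht
  simp only [Complex.zero_re, zero_add] at ht hγ'
  have hβ : 0 < β := by linarith [ht 1]
  have := ht (γ / β)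
  have h2 : (γ / β) ^ 2 * β - 2 * (γ / β) * γ = -(γ ^ 2 / β) := by field_simp; ring
  rw [h2] at this
  have : 0 < γ ^ 2 / β := by positivity
  linarith

theorem Matrix.PosDef.exists_isUnit_mul_conjTranspose {n : Type*} [Fintype n] [DecidableEq n]
    {P : Matrix n n ℂ} (hP : P.PosDef) : ∃ B : Matrix n n ℂ, IsUnit B ∧ P = B * Bᴴ := by
  open scoped MatrixOrder in
  obtain ⟨C, hC⟩ := CStarAlgebra.nonneg_iff_eq_star_mul_self.mp hP.posSemidef.nonneg
  refine ⟨Cᴴ, ?_, by simpa [star_eq_conjTranspose] using hC⟩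
  have hu := hP.isUnit
  rw [hC, isUnit_iff_isUnit_det, det_mul] at hu
  exact (isUnit_iff_isUnit_det _).2 (isUnit_of_mul_isUnit_left hu)

/-- The Cayley transform `(c - X)⁻¹ (c + X)` preserves a sesquilinear form `Q` if and only if `X`
is infinitesimally orthogonal for `Q`. -/
theorem cayley_mul_mul_conjTranspose_eq_iff {n : Type*} [Fintype n] [DecidableEq n]
    {X Q : Matrix n n ℂ} {c : ℝ} (hc : c ≠ 0) (hN : IsUnit (c • 1 - X)) :
    ((c • 1 - X)⁻¹ * (c • 1 + X)) * Q * ((c • 1 - X)⁻¹ * (c • 1 + X))ᴴ = Q ↔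
      X * Q + Q * Xᴴ = 0 := by
  have hd := (isUnit_iff_isUnit_det _).1 hN
  have hd' := (isUnit_iff_isUnit_det _).1 hN.star
  rw [star_eq_conjTranspose] at hd'
  have hdiff : (c • 1 + X) * Q * (c • 1 + X)ᴴ - (c • 1 - X) * Q * (c • 1 - X)ᴴ =
      (2 * c) • (X * Q + Q * Xᴴ) := by
    simp only [conjTranspose_add, conjTranspose_sub, conjTranspose_smul, conjTranspose_one,
      star_trivial, add_mul, mul_add, sub_mul, mul_sub, smul_mul_assoc, mul_smul_comm, one_mul,
      mul_one, smul_add, smul_sub, two_mul, add_smul]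
    abel
  have hiff : X * Q + Q * Xᴴ = 0 ↔
      (c • 1 + X) * Q * (c • 1 + X)ᴴ = (c • 1 - X) * Q * (c • 1 - X)ᴴ := by
    rw [← sub_eq_zero (a := (c • 1 + X) * Q * (c • 1 + X)ᴴ), hdiff,
      smul_eq_zero_iff_right (mul_ne_zero two_ne_zero hc)]
  rw [hiff, conjTranspose_mul, conjTranspose_nonsing_inv]
  generalize c • 1 - X = N at *
  generalize c • 1 + X = M at *
  constructor
  · intro h
    conv_rhs => rw [← h]
    simp only [← mul_assoc]
    rw [mul_nonsing_inv _ hd, one_mul, mul_assoc _ (Nᴴ)⁻¹, nonsing_inv_mul _ hd', mul_one]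
  · intro h
    calc N⁻¹ * M * Q * (Mᴴ * Nᴴ⁻¹) = N⁻¹ * (M * Q * Mᴴ) * Nᴴ⁻¹ := by simp only [mul_assoc]
      _ = Q := by
        rw [h, mul_assoc N, nonsing_inv_mul_cancel_left _ _ hd,
          mul_nonsing_inv_cancel_right _ _ hd']

theorem exists_ne_zero_isUnit_smul_one_sub {n : Type*} [Fintype n] [DecidableEq n]
    (X : Matrix n n ℂ) : ∃ c : ℝ, c ≠ 0 ∧ IsUnit (c • 1 - X) := by
  have hfin : ((fun c : ℝ => (c : ℂ)) ⁻¹' spectrum ℂ X ∪ {0}).Finite :=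
    ((Matrix.finite_spectrum X).preimage Complex.ofReal_injective.injOn).union
      (Set.finite_singleton 0)
  obtain ⟨c, hc⟩ := hfin.exists_notMem
  simp only [Set.mem_union, Set.mem_preimage, Set.mem_singleton_iff, not_or, spectrum.mem_iff,
    not_not] at hc
  refine ⟨c, hc.2, ?_⟩
  simpa [Algebra.algebraMap_eq_smul_one] using hc.1

attribute [local instance] Matrix.normedAddCommGroup Matrix.normedSpace in
/-- An infinitesimal isometry of a Hermitian symmetry `J` whose centralizer in the isometry group
is compact preserves a positive definite Hermitian form. -/
theorem exists_posDef_of_isCompact_centralizer {n : Type*} [Fintype n] [DecidableEq n]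
    {J X : Matrix n n ℂ} (hJ : J * J = 1) (hJh : J.IsHermitian) (hX : X * J + J * Xᴴ = 0)
    (hcpt : IsCompact {g | (IsUnit g ∧ g * J * gᴴ = J) ∧ g * X = X * g}) :
    ∃ P : Matrix n n ℂ, P.PosDef ∧ X * P + P * Xᴴ = 0 := by
  obtain ⟨c, hc, hN⟩ := exists_ne_zero_isUnit_smul_one_sub X
  set g := (c • 1 - X)⁻¹ * (c • 1 + X)
  have hgJ : g * J * gᴴ = J := (cayley_mul_mul_conjTranspose_eq_iff hc hN).2 hX
  have hgu : IsUnit g := by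
    refine IsUnit.of_mul_eq_one (J * gᴴ * J) ?_
    rw [← mul_assoc, ← mul_assoc, hgJ, hJ]
  have hgX : g * X = X * g := by
    have h1 : Commute (c • 1 - X) X :=
      ((Commute.one_left X).smul_left c).sub_left (Commute.refl X)
    have h2 : Commute (c • 1 + X) X :=
      ((Commute.one_left X).smul_left c).add_left (Commute.refl X)
    have h3 : Commute (c • 1 - X)⁻¹ X := by
      have hd := (isUnit_iff_isUnit_det _).1 hN
      rw [Commute, SemiconjBy, ← mul_nonsing_inv_cancel_right _ ((c • 1 - X)⁻¹ * X) hd,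
        mul_assoc _ X, ← h1.eq, nonsing_inv_mul_cancel_left _ _ hd]
    exact h3.mul_left h2
  set T : Set (Matrix n n ℂ) :=
    (fun h => h * hᴴ) '' {h | (IsUnit h ∧ h * J * hᴴ = J) ∧ h * X = X * h}
  have hTc : IsCompact T := hcpt.image (by fun_prop)
  let f : Matrix n n ℂ →ₗ[ℝ] Matrix n n ℂ :=
    LinearMap.mulRight ℝ gᴴ ∘ₗ LinearMap.mulLeft ℝ g
  have hf : Set.MapsTo f T T := by
    rintro _ ⟨h, ⟨⟨hu, hhJ⟩, hhX⟩, rfl⟩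
    refine ⟨g * h, ⟨⟨hgu.mul hu, ?_⟩, ?_⟩, ?_⟩
    · calc g * h * J * (g * h)ᴴ = g * (h * J * hᴴ) * gᴴ := by
            rw [conjTranspose_mul]; simp only [mul_assoc]
        _ = J := by rw [hhJ, hgJ]
    · rw [mul_assoc, hhX, ← mul_assoc, hgX, mul_assoc]
    · simp [f, conjTranspose_mul, mul_assoc]
  obtain ⟨P, hP, hfP⟩ := exists_fixedPoint_mem_closure_convexHull hTc
    ⟨_, 1, by simp, rfl⟩ f hf
  refine ⟨P, posDef_of_forall_posSemidef (J := J) fun t => ?_,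
    (cayley_mul_mul_conjTranspose_eq_iff hc hN).1 hfP⟩
  set Φ : Matrix n n ℂ →ᵃ[ℝ] Matrix n n ℂ :=
    (LinearMap.id + t ^ 2 • (LinearMap.mulRight ℝ J ∘ₗ LinearMap.mulLeft ℝ J)).toAffineMap -
      AffineMap.const ℝ _ ((2 * t) • (1 : Matrix n n ℂ)) with hΦ
  have hΦ_apply : ∀ Q, Φ Q = Q + t ^ 2 • (J * Q * J) - (2 * t) • (1 : Matrix n n ℂ) := fun Q => by
    simp [hΦ]
  have hcont : Continuous Φ := by
    have : ⇑Φ = fun Q => Q + t ^ 2 • (J * Q * J) - (2 * t) • (1 : Matrix n n ℂ) := funext hΦ_apply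
    rw [this]
    fun_prop
  suffices hsub : closure (convexHull ℝ T) ⊆ Φ ⁻¹' {M | M.PosSemidef} by
    have := hsub hP
    rwa [Set.mem_preimage, hΦ_apply] at this
  refine closure_minimal (convexHull_min ?_ (convex_setOf_posSemidef.affine_preimage Φ))
    (isClosed_setOf_posSemidef.preimage hcont)
  rintro _ ⟨h, ⟨⟨-, hhJ⟩, -⟩, rfl⟩
  have h1 : J * h * J * hᴴ = 1 := by rw [mul_assoc, mul_assoc, ← mul_assoc h, hhJ, hJ]
  have h2 : h * (J * (hᴴ * J)) = 1 := by rw [← mul_assoc, ← mul_assoc, hhJ, hJ]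
  rw [Set.mem_preimage, hΦ_apply, Set.mem_ofPred_eq]
  convert posSemidef_self_mul_conjTranspose (h - t • (J * h * J)) using 1
  simp only [conjTranspose_sub, conjTranspose_smul, conjTranspose_mul, hJh.eq, star_trivial,
    sub_mul, mul_sub, smul_mul_assoc, mul_smul_comm, h1, h2, two_mul, add_smul, sq, mul_smul, smul_sub]
  have h3 : J * h * J * (J * (hᴴ * J)) = J * (h * hᴴ) * J := by
    rw [← mul_assoc _ J, mul_assoc _ J J, hJ, mul_one]; simp only [mul_assoc]
  rw [h3]
  abel

/-- If `X` is infinitesimally isometric both for a diagonal symmetry and for a positive definite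
form, then it is diagonalized by an isometry of the symmetry. -/
theorem exists_isometry_mul_diagonal {n : Type*} [Fintype n] [DecidableEq n]
    {s : n → ℝ} (hs : ∀ i, s i = 1 ∨ s i = -1) {X P : Matrix n n ℂ} (hP : P.PosDef)
    (hXP : X * P + P * Xᴴ = 0)
    (hXs : X * diagonal (fun i => (s i : ℂ)) + diagonal (fun i => (s i : ℂ)) * Xᴴ = 0) :
    ∃ (g : Matrix n n ℂ) (x : n → ℝ), IsUnit g ∧
      g * diagonal (fun i => (s i : ℂ)) * gᴴ = diagonal (fun i => (s i : ℂ)) ∧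
      X * g = g * diagonal (fun i => I * (x i : ℂ)) := by
  set J : Matrix n n ℂ := diagonal (fun i => (s i : ℂ)) with hJdef
  have hJu : IsUnit J := by
    rw [hJdef, isUnit_diagonal, Pi.isUnit_iff]
    intro i
    rcases hs i with h | h <;> simp [h]
  have hJh : J.IsHermitian := isHermitian_diagonal_of_self_adjoint _ (by ext i; simp)
  obtain ⟨B, hB, rfl⟩ := hP.exists_isUnit_mul_conjTranspose
  obtain ⟨C, hBC, hCB⟩ := isUnit_iff_exists.1 hB
  have hBC' : Cᴴ * Bᴴ = 1 := by rw [← conjTranspose_mul, hBC, conjTranspose_one]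
  have hCB' : Bᴴ * Cᴴ = 1 := by rw [← conjTranspose_mul, hCB, conjTranspose_one]
  have hskew : Bᴴ * Xᴴ * Cᴴ = -(C * X * B) := by
    have h1 : C * (X * (B * Bᴴ) + B * Bᴴ * Xᴴ) * Cᴴ = C * X * B * (Bᴴ * Cᴴ) +
        (C * B) * (Bᴴ * Xᴴ * Cᴴ) := by simp only [mul_add, add_mul, mul_assoc]
    rw [hXP, hCB, hCB', mul_one, one_mul, mul_zero, zero_mul] at h1
    exact eq_neg_of_add_eq_zero_right h1.symm
  have hA : ((-I) • (C * X * B)).IsHermitian := by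
    rw [IsHermitian, conjTranspose_smul, conjTranspose_mul, conjTranspose_mul, ← mul_assoc, hskew]
    simp
  have hE : (C * J * Cᴴ).IsHermitian := isHermitian_mul_mul_conjTranspose C hJh
  have hcomm : Commute ((-I) • (C * X * B)) (C * J * Cᴴ) := by
    refine Commute.smul_left ?_ _
    have h1 : C * X * B * (C * J * Cᴴ) = C * (X * J) * Cᴴ := by
      rw [show C * X * B * (C * J * Cᴴ) = C * X * (B * C) * J * Cᴴ by simp only [mul_assoc], hBC]
      simp only [mul_assoc, one_mul]
    have h2 : C * J * Cᴴ * (Bᴴ * Xᴴ * Cᴴ) = C * (J * Xᴴ) * Cᴴ := by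
      rw [show C * J * Cᴴ * (Bᴴ * Xᴴ * Cᴴ) = C * J * (Cᴴ * Bᴴ) * Xᴴ * Cᴴ by
        simp only [mul_assoc], hBC']
      simp only [mul_assoc, one_mul]
    rw [hskew, mul_neg] at h2
    rw [Commute, SemiconjBy, h1, eq_neg_of_add_eq_zero_left hXs, mul_neg, neg_mul, ← h2, neg_neg]
  obtain ⟨U, a, b, hU, hAU, hEU⟩ := hA.exists_simultaneous_diagonalization hE hcomm
  have hU' : U * Uᴴ = 1 := mul_eq_one_comm.1 hU
  have hJ0 : J = (B * U) * diagonal (fun i => (b i : ℂ)) * (B * U)ᴴ := by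
    rw [conjTranspose_mul, ← mul_assoc, mul_assoc B, ← hEU]
    rw [show B * (C * J * Cᴴ * U) * Uᴴ * Bᴴ = (B * C) * J * Cᴴ * (U * Uᴴ) * Bᴴ by
      simp only [mul_assoc], hU', hBC, one_mul, mul_one, mul_assoc, hBC', mul_one]
  have hX0 : X * (B * U) = B * U * diagonal (fun i => I * (a i : ℂ)) := by
    have h1 : C * X * B * U = U * diagonal (fun i => I * (a i : ℂ)) := by
      have h2 : I • ((-I) • (C * X * B) * U) = I • (U * diagonal (fun i => (a i : ℂ))) := by
        rw [hAU]
      have h3 : diagonal (fun i => I * (a i : ℂ)) = I • diagonal (fun i => (a i : ℂ)) := by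
        ext i j; simp [diagonal_apply]
      rw [h3, mul_smul_comm, ← h2, smul_mul_assoc, smul_smul]
      simp
    rw [mul_assoc B, ← h1]
    rw [show B * (C * X * B * U) = (B * C) * X * B * U by simp only [mul_assoc], hBC]
    simp only [mul_assoc, one_mul]
  have hBU : IsUnit (B * U) := by
    refine IsUnit.of_mul_eq_one (Uᴴ * C) ?_
    rw [show B * U * (Uᴴ * C) = B * (U * Uᴴ) * C by simp only [mul_assoc], hU', mul_one, hBC]
  obtain ⟨σ, hσ⟩ := exists_perm_of_diagonal_eq_mul_mul_conjTranspose hBU hJ0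
  set g : Matrix n n ℂ := of fun i j => (B * U) i (σ j) * (Real.sqrt |b (σ j)| : ℂ) with hg
  have hsign : ∀ j, Real.sqrt |b (σ j)| * s j * Real.sqrt |b (σ j)| = b (σ j) := by
    intro j
    have hsq := Real.mul_self_sqrt (abs_nonneg (b (σ j)))
    rcases hs j with h | h
    · have : 0 < b (σ j) := (hσ j).2 (by rw [h]; norm_num)
      rw [h, mul_one, hsq, abs_of_pos this]
    · have : ¬ 0 < b (σ j) := fun hpos => by
        have := (hσ j).1 hpos
        rw [h] at this
        norm_num at this
      rw [h, mul_neg_one, neg_mul, hsq, abs_of_nonpos (not_lt.1 this), neg_neg]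
  have hgJ : g * J * gᴴ = J := by
    conv_rhs => rw [hJ0]
    ext i k
    rw [hJdef, mul_apply, mul_apply]
    refine Fintype.sum_equiv σ _ _ fun j => ?_
    simp only [hg, mul_diagonal, conjTranspose_apply, of_apply, star_mul', RCLike.star_def,
      conj_ofReal]
    have := congrArg (fun r : ℝ => (r : ℂ)) (hsign j)
    push_cast at this
    rw [← this]
    ring
  refine ⟨g, a ∘ σ, ?_, hgJ, ?_⟩
  · have h1 := hJu
    rw [← hgJ, isUnit_iff_isUnit_det, det_mul, det_mul] at h1
    exact (isUnit_iff_isUnit_det _).2 (isUnit_of_mul_isUnit_left (isUnit_of_mul_isUnit_left h1))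
  · ext i j
    have h1 := congrFun (congrFun hX0 i) (σ j)
    rw [mul_apply, mul_diagonal] at h1
    rw [mul_apply, mul_diagonal]
    simp only [hg, of_apply, Function.comp_apply, ← mul_assoc, ← Finset.sum_mul]
    rw [h1]
    ring

end

theorem statement5 (p q : ℕ) (hq : 1 ≤ q) (hpq : q ≤ p)
    (X : Matrix (Fin (p + q)) (Fin (p + q)) ℂ) (hX : X ∈ upqLie p q)
    (hcpt : IsCompact {g | g ∈ Upq p q ∧ g * X = X * g}) :
    ∃ g ∈ Upq p q, ∃ x : Fin (p + q) → ℝ, X = g * dmat x * g⁻¹ := by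
  set s : Fin (p + q) → ℝ := fun i => if (i : ℕ) < p then 1 else -1 with hs
  have hsign : ∀ i, s i = 1 ∨ s i = -1 := fun i => by
    by_cases h : (i : ℕ) < p <;> simp [hs, h]
  have hI : Ipq p q = diagonal (fun i => (s i : ℂ)) := by
    simp only [Ipq, hs]
    congr 1
    funext i
    split_ifs <;> simp
  have hJ : Ipq p q * Ipq p q = 1 := by
    rw [hI, diagonal_mul_diagonal, ← diagonal_one]
    congr 1
    funext i
    rcases hsign i with h | h <;> simp [h]
  have hJh : (Ipq p q).IsHermitian := by
    rw [hI]
    exact isHermitian_diagonal_of_self_adjoint _ (by ext i; simp)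
  obtain ⟨P, hP, hXP⟩ := exists_posDef_of_isCompact_centralizer hJ hJh hX hcpt
  have hX' : X * Ipq p q + Ipq p q * Xᴴ = 0 := hX
  rw [hI] at hX'
  obtain ⟨g, x, hg, hgJ, hgX⟩ := exists_isometry_mul_diagonal hsign hP hXP hX'
  rw [← hI] at hgJ
  refine ⟨g, ⟨hg, hgJ⟩, x, ?_⟩
  rw [dmat, ← hgX, mul_nonsing_inv_cancel_right _ _ ((isUnit_iff_isUnit_det g).1 hg)]
end

section
/- For every x ∈ C_{p,q} and every R ∈ ℝ, the set {Y ∈ O_x : Im(Tr(Y · I_{p,q})) ≤ R} is a compact subset of M_n(ℂ). -/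
open Matrix Complex Pointwise

/-- The trace of `g * diagonal d * gᴴ` weighs the squared norms of the entries of `g` by `d`. -/
lemma trace_mul_diagonal_mul_conjTranspose {n : ℕ} (g : Matrix (Fin n) (Fin n) ℂ)
    (d : Fin n → ℂ) :
    (g * Matrix.diagonal d * gᴴ).trace = ∑ j, ∑ k, d k * (Complex.normSq (g j k) : ℂ) := by
  simp only [Matrix.trace, Matrix.diag, Matrix.mul_apply (M := g * Matrix.diagonal d),
    Matrix.mul_diagonal, Matrix.conjTranspose_apply]
  refine Finset.sum_congr rfl fun j _ => Finset.sum_congr rfl fun k _ => ?_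
  rw [← Complex.mul_conj, ← starRingEnd_apply]
  ring

/-- A matrix preserving the Hermitian form `Ipq` has inverse `Ipq * gᴴ * Ipq`. -/
lemma mul_Ipq_conjTranspose_Ipq {p q : ℕ} {g : Matrix (Fin (p + q)) (Fin (p + q)) ℂ}
    (hg : g * Ipq p q * gᴴ = Ipq p q) : g * (Ipq p q * gᴴ * Ipq p q) = 1 := by
  rw [← Ipq_mul_self p q, ← mul_assoc, ← mul_assoc, hg]

/-- The orbit sublevel set is parametrized by a sublevel set in `U(p,q)` through a map that
does not involve matrix inversion. -/
lemma orbit_sublevel_eq_image (p q : ℕ) (x : Fin (p + q) → ℝ) (R : ℝ) :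
    {Y | Y ∈ Orbit p q x ∧ ((Y * Ipq p q).trace).im ≤ R} =
      (fun g => g * (dmat x * Ipq p q) * gᴴ * Ipq p q) ''
        {g | g * Ipq p q * gᴴ = Ipq p q ∧ ((g * (dmat x * Ipq p q) * gᴴ).trace).im ≤ R} := by
  have key : ∀ g : Matrix (Fin (p + q)) (Fin (p + q)) ℂ, g * Ipq p q * gᴴ = Ipq p q →
      g * dmat x * g⁻¹ = g * (dmat x * Ipq p q) * gᴴ * Ipq p q := by
    intro g hg
    rw [Matrix.inv_eq_right_inv (mul_Ipq_conjTranspose_Ipq hg)]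
    simp only [mul_assoc]
  have tr : ∀ A : Matrix (Fin (p + q)) (Fin (p + q)) ℂ, A * Ipq p q * Ipq p q = A := by
    intro A
    rw [mul_assoc, Ipq_mul_self, mul_one]
  ext Y
  constructor
  · rintro ⟨⟨g, ⟨-, hg⟩, rfl⟩, hR⟩
    rw [key g hg, tr] at hR
    exact ⟨g, ⟨hg, hR⟩, (key g hg).symm⟩
  · rintro ⟨g, ⟨hg, hR⟩, rfl⟩
    refine ⟨⟨g, ⟨?_, hg⟩, (key g hg).symm⟩, ?_⟩
    · exact IsUnit.of_mul_eq_one _ (mul_Ipq_conjTranspose_Ipq hg)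
    · simpa only [tr] using hR

/-- A point of the holomorphic chamber can be separated with a uniform gap. -/
lemma exists_gap_of_mem_Chol {p q : ℕ} (hp : 1 ≤ p) (hq : 1 ≤ q) {x : Fin (p + q) → ℝ}
    (hx : x ∈ Chol p q) :
    ∃ t δ : ℝ, 0 < δ ∧ ∀ k : Fin (p + q), δ ≤ (x k - t) * (if (k : ℕ) < p then 1 else -1) := by
  obtain ⟨hmono, hlt⟩ := hx
  let a : Fin (p + q) := ⟨p - 1, by omega⟩
  let b : Fin (p + q) := ⟨p, by omega⟩
  have hab : x b < x a := hlt a b (by simp only [a]; omega) le_rfl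
  refine ⟨(x a + x b) / 2, (x a - x b) / 2, by linarith, fun k => ?_⟩
  split_ifs with hk
  · have := hmono k a (by simp only [a]; omega) (Or.inl (by simp only [a]; omega))
    linarith
  · have := hmono b k (by simp only [b]; omega) (Or.inr le_rfl)
    linarith

/-- On `U(p,q)`, the height function controls the squared Hilbert–Schmidt norm. -/
lemma gap_mul_sum_normSq_le {p q : ℕ} {x : Fin (p + q) → ℝ} {t δ : ℝ}
    (hgap : ∀ k : Fin (p + q), δ ≤ (x k - t) * (if (k : ℕ) < p then 1 else -1))
    {g : Matrix (Fin (p + q)) (Fin (p + q)) ℂ} (hg : g * Ipq p q * gᴴ = Ipq p q) :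
    δ * ∑ j, ∑ k, Complex.normSq (g j k) ≤
      ((g * (dmat x * Ipq p q) * gᴴ).trace).im - t * ((Ipq p q).trace).re := by
  have h₁ : ((g * (dmat x * Ipq p q) * gᴴ).trace).im =
      ∑ j, ∑ k : Fin (p + q), x k * (if (k : ℕ) < p then 1 else -1) * Complex.normSq (g j k) := by
    rw [dmat, Ipq, Matrix.diagonal_mul_diagonal, trace_mul_diagonal_mul_conjTranspose]
    simp only [Complex.im_sum]
    refine Finset.sum_congr rfl fun j _ => Finset.sum_congr rfl fun k _ => ?_
    split_ifs <;> simp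
  have h₂ : ((Ipq p q).trace).re =
      ∑ j, ∑ k : Fin (p + q), (if (k : ℕ) < p then 1 else -1) * Complex.normSq (g j k) := by
    rw [← hg, Ipq, trace_mul_diagonal_mul_conjTranspose]
    simp only [Complex.re_sum]
    refine Finset.sum_congr rfl fun j _ => Finset.sum_congr rfl fun k _ => ?_
    split_ifs <;> simp
  rw [h₁, h₂]
  simp only [Finset.mul_sum, ← Finset.sum_sub_distrib]
  refine Finset.sum_le_sum fun j _ => Finset.sum_le_sum fun k _ => ?_
  have := mul_le_mul_of_nonneg_right (hgap k) (Complex.normSq_nonneg (g j k))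
  linarith

/-- Sublevel sets of the height function on `U(p,q)` are compact. -/
lemma isCompact_Upq_sublevel {p q : ℕ} (hp : 1 ≤ p) (hq : 1 ≤ q) {x : Fin (p + q) → ℝ}
    (hx : x ∈ Chol p q) (R : ℝ) :
    IsCompact {g : Matrix (Fin (p + q)) (Fin (p + q)) ℂ |
      g * Ipq p q * gᴴ = Ipq p q ∧ ((g * (dmat x * Ipq p q) * gᴴ).trace).im ≤ R} := by
  obtain ⟨t, δ, hδ, hgap⟩ := exists_gap_of_mem_Chol hp hq hx
  set C : ℝ := (R - t * ((Ipq p q).trace).re) / δ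
  have hbox : IsCompact (Set.univ.pi fun _ => Set.univ.pi fun _ =>
      Metric.closedBall (0 : ℂ) (√C) : Set (Fin (p + q) → Fin (p + q) → ℂ)) :=
    isCompact_univ_pi fun _ => isCompact_univ_pi fun _ => isCompact_closedBall _ _
  refine IsCompact.of_isClosed_subset hbox ?_ ?_
  · rw [Set.ofPred_and]
    refine IsClosed.inter (isClosed_eq ?_ continuous_const) (isClosed_le ?_ continuous_const)
    · fun_prop
    · exact Complex.continuous_im.comp (Continuous.matrix_trace (by fun_prop))
  · rintro g ⟨hg, hR⟩ j - k -
    have hsum : ∑ j, ∑ k, Complex.normSq (g j k) ≤ C := by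
      rw [le_div_iff₀ hδ]
      linarith [gap_mul_sum_normSq_le hgap hg]
    have hjk : Complex.normSq (g j k) ≤ ∑ j, ∑ k, Complex.normSq (g j k) :=
      (Finset.single_le_sum (f := fun k => Complex.normSq (g j k))
        (fun k _ => Complex.normSq_nonneg _) (Finset.mem_univ k)).trans
      (Finset.single_le_sum (f := fun j => ∑ k, Complex.normSq (g j k))
        (fun j _ => Finset.sum_nonneg fun k _ => Complex.normSq_nonneg _) (Finset.mem_univ j))
    rw [mem_closedBall_zero_iff]
    refine Real.le_sqrt_of_sq_le ?_
    rw [← Complex.normSq_eq_norm_sq]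
    exact hjk.trans hsum

theorem statement10 (p q : ℕ) (hq : 1 ≤ q) (hpq : q ≤ p)
    (x : Fin (p + q) → ℝ) (hx : x ∈ Chol p q) (R : ℝ) :
    IsCompact {Y | Y ∈ Orbit p q x ∧ ((Y * Ipq p q).trace).im ≤ R} := by
  rw [orbit_sublevel_eq_image]
  have hcont : Continuous fun g : Matrix (Fin (p + q)) (Fin (p + q)) ℂ =>
      g * (dmat x * Ipq p q) * gᴴ * Ipq p q :=
    ((continuous_id.matrix_mul continuous_const).matrix_mul
      continuous_id.matrix_conjTranspose).matrix_mul continuous_const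
  have hp : 1 ≤ p := hq.trans hpq
  exact (isCompact_Upq_sublevel hp hq hx R).image hcont
end
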